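/- For sequences f, g, h ∈ ℓ²(ℤ) one has ‖ |D_d|^{-1/8}(fgh) ‖_{ℓ^{4/3}(ℤ)} ≲ ‖ |D_d|^{-1/8} f ‖_{ℓ²(ℤ)} · ‖ |D_d|^{3/8} g ‖_{ℓ²(ℤ)} · ‖ |D_d|^{3/8} h ‖_{ℓ²(ℤ)}, where |D_d|^s is the discrete Fourier multiplier with symbol |sin θ|^s on [-π, π]. -/

import Mathlib

open MeasureTheory Real

/-- Discrete-time Fourier transform `â(θ) = Σ_n a_n e^{-inθ}` (absolutely convergent
for `a ∈ ℓ¹`, e.g. a pointwise product of three `ℓ²` sequences). -/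
noncomputable def dtft (a : ℤ → ℂ) (θ : ℝ) : ℂ :=
  ∑' n : ℤ, a n * Complex.exp (-(Complex.I * n * θ))

/-- Japanese-bracket type weight on the integers. -/
noncomputable def br (k : ℤ) : ℝ := 1 + |(k : ℝ)|

lemma br_one_le (k : ℤ) : 1 ≤ br k := by unfold br; have := abs_nonneg (k : ℝ); linarith
lemma br_pos (k : ℤ) : 0 < br k := lt_of_lt_of_le one_pos (br_one_le k)
lemma br_neg (k : ℤ) : br (-k) = br k := by simp [br]
lemma br_natAbs (k : ℤ) : br k = (k.natAbs : ℝ) + 1 := by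
  unfold br; rw [Nat.cast_natAbs]; push_cast; ring

lemma sum_natAbs_le (φ : ℕ → ℝ) (hφ : ∀ j, 0 ≤ φ j) (F : Finset ℤ) :
    ∑ k ∈ F, φ k.natAbs ≤ 2 * ∑ j ∈ F.image Int.natAbs, φ j := by
  rw [Finset.sum_comp, Finset.mul_sum]
  apply Finset.sum_le_sum
  intro j _
  rw [nsmul_eq_mul]
  apply mul_le_mul_of_nonneg_right _ (hφ j)
  have : (F.filter (fun a => a.natAbs = j)) ⊆ {(j : ℤ), -(j : ℤ)} := by
    intro a ha
    simp only [Finset.mem_filter] at ha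
    simp only [Finset.mem_insert, Finset.mem_singleton]
    omega
  have h2 := (Finset.card_le_card this).trans Finset.card_le_two
  exact_mod_cast h2

lemma sum_range_rpow_le (a : ℝ) (ha0 : 0 ≤ a) (ha : a < 1) (M : ℕ) :
    ∑ j ∈ Finset.range M, ((j : ℝ) + 1) ^ (-a) ≤ (M : ℝ) ^ (1 - a) / (1 - a) := by
  induction M with
  | zero => simp; rw [Real.zero_rpow (by linarith)]; simp
  | succ M ih =>
    rw [Finset.sum_range_succ]
    have hM : (0 : ℝ) < (M : ℝ) + 1 := by positivity
    have hb := rpow_one_add_le_one_add_mul_self (s := -1 / ((M : ℝ) + 1)) (p := 1 - a)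
      (by rw [le_div_iff₀ hM]; have : (0:ℝ) ≤ M := by positivity
          linarith) (by linarith) (by linarith)
    have e : (1 : ℝ) + -1 / ((M : ℝ) + 1) = M / ((M : ℝ) + 1) := by field_simp; ring
    rw [e, Real.div_rpow (by positivity) hM.le, div_le_iff₀ (by positivity)] at hb
    have e2 : ((M : ℝ) + 1) ^ (1 - a) = ((M : ℝ) + 1) * ((M : ℝ) + 1) ^ (-a) := by
      rw [sub_eq_add_neg, Real.rpow_add hM, Real.rpow_one]
    have h1a : 0 < 1 - a := by linarith
    push_cast
    rw [le_div_iff₀ h1a] at ih ⊢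
    rw [e2] at hb ⊢
    have : (1 + (1 - a) * (-1 / ((M : ℝ) + 1))) * (((M : ℝ) + 1) * ((M : ℝ) + 1) ^ (-a))
       = ((M : ℝ) + 1) * ((M : ℝ) + 1) ^ (-a) - (1 - a) * ((M : ℝ) + 1) ^ (-a) := by
      field_simp; ring
    rw [this] at hb
    nlinarith

lemma one_add_mul_le_rpow_neg {s p : ℝ} (hs : 0 ≤ s) (hp : 0 < p) :
    1 + p * (s / (1 + s)) ≤ (1 + s) ^ p := by
  have h1 : 0 < 1 + s := by linarith
  have h2 := Real.one_sub_inv_le_log_of_pos h1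
  have h3 : s / (1 + s) = 1 - (1 + s)⁻¹ := by field_simp; ring
  rw [Real.rpow_def_of_pos h1, h3]
  have := Real.add_one_le_exp (Real.log (1 + s) * p)
  nlinarith

lemma sum_Ico_rpow_le (b : ℝ) (hb : 1 < b) (M T : ℕ) (hM : 1 ≤ M) (hT : M ≤ T) :
    ∑ j ∈ Finset.Ico M T, ((j : ℝ) + 1) ^ (-b)
      ≤ ((M : ℝ) ^ (1 - b) - (T : ℝ) ^ (1 - b)) / (b - 1) := by
  induction T, hT using Nat.le_induction with
  | base => simp
  | succ T hT ih =>
    rw [Finset.sum_Ico_succ_top hT]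
    have hT0 : (0 : ℝ) < T := by exact_mod_cast (by omega : 0 < T)
    have hb1 : 0 < b - 1 := by linarith
    have h := one_add_mul_le_rpow_neg (s := 1 / (T : ℝ)) (p := b - 1) (by positivity) hb1
    have e : (1 : ℝ) + 1 / (T : ℝ) = ((T : ℝ) + 1) / T := by field_simp
    rw [e, Real.div_rpow (by positivity) hT0.le, le_div_iff₀ (by positivity)] at h
    have e3 : (1 / (T : ℝ)) / (((T : ℝ) + 1) / T) = 1 / ((T : ℝ) + 1) := by field_simp
    rw [e3] at h
    have q : (0 : ℝ) < ((T : ℝ) + 1) := by positivity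
    have e4 : (T : ℝ) ^ (1 - b) = ((T : ℝ) ^ (b - 1))⁻¹ := by
      rw [← Real.rpow_neg hT0.le]; congr 1; ring
    have e5 : ((T : ℝ) + 1) ^ (1 - b) = (((T : ℝ) + 1) ^ (b - 1))⁻¹ := by
      rw [← Real.rpow_neg q.le]; congr 1; ring
    have e6 : ((T : ℝ) + 1) ^ (- b) = (((T : ℝ) + 1) ^ (b - 1))⁻¹ * ((T : ℝ) + 1)⁻¹ := by
      rw [← Real.rpow_neg q.le, ← Real.rpow_neg_one ((T : ℝ) + 1), ← Real.rpow_add q]; congr 1; ring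
    have p1 : 0 < (T : ℝ) ^ (b - 1) := by positivity
    have p2 : 0 < ((T : ℝ) + 1) ^ (b - 1) := by positivity
    push_cast
    rw [le_div_iff₀ hb1] at ih ⊢
    rw [e5, e6]
    rw [e4] at ih
    set X := (T : ℝ) ^ (b - 1)
    set Y := ((T : ℝ) + 1) ^ (b - 1)
    have h' : X⁻¹ - Y⁻¹ ≥ Y⁻¹ * ((T : ℝ) + 1)⁻¹ * (b - 1) := by
      have : Y⁻¹ * (1 + (b - 1) * (1 / ((T : ℝ) + 1))) ≤ X⁻¹ := by
        rw [inv_mul_le_iff₀ p2, ← div_eq_mul_inv, le_div_iff₀ p1]; exact h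
      have e7 : Y⁻¹ * (1 + (b - 1) * (1 / ((T : ℝ) + 1))) = Y⁻¹ + Y⁻¹ * ((T : ℝ) + 1)⁻¹ * (b - 1) := by
        rw [one_div]; ring
      linarith
    nlinarith

lemma near_sum (a : ℝ) (ha0 : 0 ≤ a) (ha : a < 1) : ∃ C > 0, ∀ R > (0 : ℝ), ∀ F : Finset ℤ,
    ∑ k ∈ F with br k ≤ R, br k ^ (-a) ≤ C * R ^ (1 - a) := by
  have h1a : 0 < 1 - a := by linarith
  refine ⟨2 / (1 - a), by positivity, fun R hR F => ?_⟩
  have h := sum_natAbs_le (fun j => ((j : ℝ) + 1) ^ (-a)) (fun j => by positivity)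
    (F.filter (fun k => br k ≤ R))
  simp only [← br_natAbs] at h
  refine h.trans ?_
  have hsub : (F.filter (fun k => br k ≤ R)).image Int.natAbs ⊆ Finset.range ⌊R⌋₊ := by
    intro j hj
    simp only [Finset.mem_image, Finset.mem_filter] at hj
    obtain ⟨k, ⟨_, hk⟩, rfl⟩ := hj
    rw [br_natAbs] at hk
    rw [Finset.mem_range, ← Nat.succ_le_iff, Nat.le_floor_iff hR.le]
    push_cast; exact hk
  have h2 := Finset.sum_le_sum_of_subset_of_nonneg hsub
    (f := fun j : ℕ => ((j : ℝ) + 1) ^ (-a)) (fun j _ _ => by positivity)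
  have h3 := sum_range_rpow_le a ha0 ha ⌊R⌋₊
  have h4 : ((⌊R⌋₊ : ℕ) : ℝ) ^ (1 - a) ≤ R ^ (1 - a) :=
    Real.rpow_le_rpow (by positivity) (Nat.floor_le hR.le) h1a.le
  have h5 : ((⌊R⌋₊ : ℕ) : ℝ) ^ (1 - a) / (1 - a) ≤ R ^ (1 - a) / (1 - a) := by gcongr
  calc _ ≤ 2 * (R ^ (1 - a) / (1 - a)) := by linarith
    _ = _ := by ring

lemma far_sum (b : ℝ) (hb : 1 < b) : ∃ C > 0, ∀ R > (0 : ℝ), ∀ F : Finset ℤ,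
    ∑ k ∈ F with ¬ br k ≤ R, br k ^ (-b) ≤ C * R ^ (1 - b) := by
  have hb1 : 0 < b - 1 := by linarith
  refine ⟨2 * (1 + 1 / (b - 1)) + 2 * ((1 / 2 : ℝ) ^ (1 - b) / (b - 1)), by positivity, fun R hR F => ?_⟩
  have h := sum_natAbs_le (fun j => ((j : ℝ) + 1) ^ (-b)) (fun j => by positivity)
    (F.filter (fun k => ¬ br k ≤ R))
  simp only [← br_natAbs] at h
  refine h.trans ?_
  set I := (F.filter (fun k => ¬ br k ≤ R)).image Int.natAbs
  have hR1 : 0 < R ^ (1 - b) := by positivity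
  have hmem : ∀ j ∈ I, ⌊R⌋₊ ≤ j := by
    intro j hj
    simp only [I, Finset.mem_image, Finset.mem_filter] at hj
    obtain ⟨k, ⟨_, hk⟩, rfl⟩ := hj
    rw [br_natAbs, not_le] at hk
    have := (Nat.floor_lt hR.le (n := k.natAbs + 1)).2 (by push_cast; exact hk)
    omega
  have key : ∀ M : ℕ, 1 ≤ M → ∀ J : Finset ℕ, (∀ j ∈ J, M ≤ j) →
      ∑ j ∈ J, ((j : ℝ) + 1) ^ (-b) ≤ (M : ℝ) ^ (1 - b) / (b - 1) := by
    intro M hM J hJ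
    have hsub : J ⊆ Finset.Ico M (M + (J.sup id) + 1) := by
      intro j hj
      have := Finset.le_sup (f := id) hj
      simp only [id] at this
      have := hJ j hj
      simp; omega
    refine (Finset.sum_le_sum_of_subset_of_nonneg hsub (fun j _ _ => by positivity)).trans ?_
    refine (sum_Ico_rpow_le b hb M _ hM (by omega)).trans ?_
    gcongr
    have : (0 : ℝ) ≤ ((M + (J.sup id) + 1 : ℕ) : ℝ) ^ (1 - b) := by positivity
    linarith
  have hc1 : 0 < 1 / (b - 1) := by positivity
  have hc2 : 0 < (1 / 2 : ℝ) ^ (1 - b) / (b - 1) := by positivity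
  by_cases hR' : 1 ≤ R
  · have hM : 1 ≤ ⌊R⌋₊ := by rwa [Nat.one_le_floor_iff]
    have h1 := key _ hM I hmem
    have h2 : (1 / 2) * R ≤ (⌊R⌋₊ : ℝ) := by
      have := Nat.lt_floor_add_one R
      have : (1 : ℝ) ≤ (⌊R⌋₊ : ℝ) := by exact_mod_cast hM
      linarith
    have h3 : (⌊R⌋₊ : ℝ) ^ (1 - b) ≤ ((1 / 2) * R) ^ (1 - b) :=
      Real.rpow_le_rpow_of_nonpos (by positivity) h2 (by linarith)
    rw [Real.mul_rpow (by positivity) hR.le] at h3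
    have h4 : (⌊R⌋₊ : ℝ) ^ (1 - b) / (b - 1) ≤ (1 / 2 : ℝ) ^ (1 - b) * R ^ (1 - b) / (b - 1) := by gcongr
    have h5 : (1 / 2 : ℝ) ^ (1 - b) * R ^ (1 - b) / (b - 1) = (1 / 2 : ℝ) ^ (1 - b) / (b - 1) * R ^ (1 - b) := by ring
    have : 0 < (1 + 1 / (b - 1)) * R ^ (1 - b) := by positivity
    nlinarith
  · have h1 : 1 ≤ R ^ (1 - b) :=
      Real.one_le_rpow_of_pos_of_le_one_of_nonpos hR (by linarith) (by linarith)
    have h2 : ∑ j ∈ I, ((j : ℝ) + 1) ^ (-b) ≤ 1 + 1 / (b - 1) := by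
      have hsub : I ⊆ insert 0 (I.erase 0) := by
        intro j hj; by_cases h0 : j = 0 <;> simp [h0, hj]
      refine (Finset.sum_le_sum_of_subset_of_nonneg hsub (fun j _ _ => by positivity)).trans ?_
      rw [Finset.sum_insert (by simp)]
      have := key 1 le_rfl (I.erase 0) (by intro j hj; simp at hj; omega)
      simp at this ⊢
      linarith
    have : 0 < (1 / 2 : ℝ) ^ (1 - b) / (b - 1) * R ^ (1 - b) := by positivity
    nlinarith

lemma holder_bd {ι : Type*} (F : Finset ι) (x y : ι → ℝ) (p q A B : ℝ) (hp : 1 < p)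
    (hpq : p⁻¹ + q⁻¹ = 1) (hx : ∀ i ∈ F, 0 ≤ x i) (hy : ∀ i ∈ F, 0 ≤ y i)
    (hA : ∑ i ∈ F, x i ^ p ≤ A) (hB : ∑ i ∈ F, y i ^ q ≤ B) :
    ∑ i ∈ F, x i * y i ≤ A ^ (1 / p) * B ^ (1 / q) := by
  have hc : p.HolderConjugate q := (Real.holderConjugate_iff).2 ⟨hp, hpq⟩
  refine (Real.inner_le_Lp_mul_Lq_of_nonneg F hc hx hy).trans ?_
  have h1 : 0 ≤ ∑ i ∈ F, x i ^ p := Finset.sum_nonneg fun i hi => Real.rpow_nonneg (hx i hi) _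
  have h2 : 0 ≤ ∑ i ∈ F, y i ^ q := Finset.sum_nonneg fun i hi => Real.rpow_nonneg (hy i hi) _
  have := hc.pos
  have := hc.symm.pos
  gcongr
  exact Real.rpow_nonneg (h1.trans hA) _

lemma near_sum_inj (a : ℝ) (ha0 : 0 ≤ a) (ha : a < 1) : ∃ C > 0, ∀ R > (0 : ℝ),
    ∀ F : Finset ℤ, ∀ e : ℤ → ℤ, Function.Injective e →
    ∑ k ∈ F with br (e k) ≤ R, br (e k) ^ (-a) ≤ C * R ^ (1 - a) := by
  obtain ⟨C, hC, h⟩ := near_sum a ha0 ha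
  refine ⟨C, hC, fun R hR F e he => ?_⟩
  have := h R hR (F.image e)
  rwa [Finset.filter_image, Finset.sum_image (fun x _ y _ hxy => he hxy)] at this

lemma far_sum_inj (b : ℝ) (hb : 1 < b) : ∃ C > 0, ∀ R > (0 : ℝ),
    ∀ F : Finset ℤ, ∀ e : ℤ → ℤ, Function.Injective e →
    ∑ k ∈ F with ¬ br (e k) ≤ R, br (e k) ^ (-b) ≤ C * R ^ (1 - b) := by
  obtain ⟨C, hC, h⟩ := far_sum b hb
  refine ⟨C, hC, fun R hR F e he => ?_⟩
  have := h R hR (F.image e)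
  rwa [Finset.filter_image, Finset.sum_image (fun x _ y _ hxy => he hxy)] at this

lemma hls_one (α : ℝ) (h1 : 1 / 8 < α) (h2 : α < 1) : ∃ C > 0, ∀ t > (0 : ℝ), ∀ (a : ℤ → ℝ)
    (A : Finset ℤ) (e : ℤ → ℤ), Function.Injective e → (∀ n ∈ A, 0 ≤ a n) → (∀ n ∈ A, a n ≤ t) →
    ∑ n ∈ A, a n ≤ 1 →
    ∑ n ∈ A, a n ^ α * br (e n) ^ (-(7 / 8) : ℝ) ≤ C * t ^ (α - 1 / 8) := by
  have h3 : 0 < 1 - α := by linarith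
  obtain ⟨C1, hC1, H1⟩ := near_sum_inj (7 / 8) (by norm_num) (by norm_num)
  obtain ⟨C2, hC2, H2⟩ := far_sum_inj (7 / (8 * (1 - α))) (by rw [lt_div_iff₀ (by positivity)]; linarith)
  refine ⟨C1 + C2 ^ (1 - α), by positivity, fun t ht a A e he ha hat hs => ?_⟩
  rw [← Finset.sum_filter_add_sum_filter_not A (fun n => br (e n) ≤ 1 / t), add_mul]
  apply add_le_add
  · calc ∑ n ∈ A with br (e n) ≤ 1 / t, a n ^ α * br (e n) ^ (-(7 / 8) : ℝ)
        ≤ ∑ n ∈ A with br (e n) ≤ 1 / t, t ^ α * br (e n) ^ (-(7 / 8) : ℝ) := by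
          apply Finset.sum_le_sum
          intro n hn
          have hn := (Finset.mem_filter.1 hn).1
          have := br_pos (e n)
          gcongr
          · exact ha n hn
          · exact hat n hn
      _ ≤ t ^ α * (C1 * (1 / t) ^ (1 - 7 / 8 : ℝ)) := by
          rw [← Finset.mul_sum]
          gcongr
          exact H1 (1 / t) (by positivity) A e he
      _ = C1 * t ^ (α - 1 / 8) := by
          rw [one_div, Real.inv_rpow ht.le, ← Real.rpow_neg ht.le, mul_left_comm, ← Real.rpow_add ht]
          norm_num; left; rfl
  · have hα : 0 < α := by linarith
    have := holder_bd (A.filter (fun n => ¬ br (e n) ≤ 1 / t)) (fun n => a n ^ α)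
      (fun n => br (e n) ^ (-(7 / 8) : ℝ)) (1 / α) (1 / (1 - α)) 1
      (C2 * (1 / t) ^ (1 - 7 / (8 * (1 - α)))) (by rw [lt_div_iff₀ hα]; linarith) (by simp)
      (fun n hn => Real.rpow_nonneg (ha n (Finset.mem_filter.1 hn).1) _)
      (fun n hn => Real.rpow_nonneg (br_pos _).le _) ?_ ?_
    · refine this.trans (le_of_eq ?_)
      rw [Real.one_rpow, one_mul, Real.mul_rpow hC2.le (by positivity), one_div_one_div,
        ← Real.rpow_mul (by positivity), one_div, Real.inv_rpow ht.le, ← Real.rpow_neg ht.le]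
      congr 2
      field_simp
      ring
    · refine le_trans ?_ hs
      refine le_trans (le_of_eq (Finset.sum_congr rfl fun n hn => ?_)) 
        (Finset.sum_le_sum_of_subset_of_nonneg (Finset.filter_subset _ _) (fun n hn _ => ha n hn))
      rw [← Real.rpow_mul (ha n (Finset.mem_filter.1 hn).1), mul_one_div_cancel hα.ne', Real.rpow_one]
    · refine le_trans (le_of_eq (Finset.sum_congr rfl fun n hn => ?_)) 
        (H2 (1 / t) (by positivity) A e he)
      rw [← Real.rpow_mul (br_pos _).le]
      congr 1
      field_simp

lemma hls_norm : ∃ C > 0, ∀ (a b : ℤ → ℝ) (A B : Finset ℤ), (∀ n, 0 ≤ a n) → (∀ n, 0 ≤ b n) →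
    ∑ n ∈ A, a n ≤ 1 → ∑ n ∈ B, b n ≤ 1 →
    ∑ n ∈ A, ∑ m ∈ B, a n ^ (1 / 4 : ℝ) * b m ^ (7 / 8 : ℝ) * br (n - m) ^ (-(7 / 8) : ℝ) ≤ C := by
  obtain ⟨C1, hC1, H1⟩ := hls_one (1 / 4) (by norm_num) (by norm_num)
  obtain ⟨C2, hC2, H2⟩ := hls_one (7 / 8) (by norm_num) (by norm_num)
  refine ⟨C1 + C2, by positivity, fun a b A B ha hb hA hB => ?_⟩
  have hsplit : ∀ n ∈ A, ∀ m ∈ B, a n ^ (1 / 4 : ℝ) * b m ^ (7 / 8 : ℝ) * br (n - m) ^ (-(7 / 8) : ℝ)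
      ≤ (if a n ≤ b m then a n ^ (1 / 4 : ℝ) * b m ^ (7 / 8 : ℝ) * br (n - m) ^ (-(7 / 8) : ℝ) else 0)
       + (if b m ≤ a n then a n ^ (1 / 4 : ℝ) * b m ^ (7 / 8 : ℝ) * br (n - m) ^ (-(7 / 8) : ℝ) else 0) := by
    intro n _ m _
    have := br_pos (n - m)
    have : 0 ≤ a n ^ (1 / 4 : ℝ) * b m ^ (7 / 8 : ℝ) * br (n - m) ^ (-(7 / 8) : ℝ) := by
      have := ha n; have := hb m; positivity
    rcases le_total (a n) (b m) with h | h <;> simp only [h, if_true] <;> split_ifs <;> linarith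
  refine (Finset.sum_le_sum fun n hn => Finset.sum_le_sum fun m hm => hsplit n hn m hm).trans ?_
  simp only [Finset.sum_add_distrib]
  apply add_le_add
  · rw [Finset.sum_comm]
    calc _ ≤ ∑ m ∈ B, C1 * b m := ?_
      _ ≤ C1 := by rw [← Finset.mul_sum]; nlinarith
    apply Finset.sum_le_sum
    intro m hm
    rw [← Finset.sum_filter]
    rcases (hb m).eq_or_lt with h0 | h0
    · rw [← h0]; simp
    · have := H1 (b m) h0 a (A.filter (fun n => a n ≤ b m)) (fun n => n - m)
        (fun x y h => by simpa using h) (fun n _ => ha n) (fun n hn => (Finset.mem_filter.1 hn).2)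
        ((Finset.sum_le_sum_of_subset_of_nonneg (Finset.filter_subset _ _) (fun n _ _ => ha n)).trans hA)
      calc _ = b m ^ (7 / 8 : ℝ) * ∑ n ∈ A with a n ≤ b m, a n ^ (1 / 4 : ℝ) * br (n - m) ^ (-(7 / 8) : ℝ) := by
            rw [Finset.mul_sum]; exact Finset.sum_congr rfl fun n _ => by ring
        _ ≤ b m ^ (7 / 8 : ℝ) * (C1 * b m ^ (1 / 4 - 1 / 8 : ℝ)) := by gcongr
        _ = C1 * b m := by
            rw [mul_left_comm, ← Real.rpow_add h0]; norm_num
  · calc _ ≤ ∑ n ∈ A, C2 * a n := ?_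
      _ ≤ C2 := by rw [← Finset.mul_sum]; nlinarith
    apply Finset.sum_le_sum
    intro n hn
    rw [← Finset.sum_filter]
    rcases (ha n).eq_or_lt with h0 | h0
    · rw [← h0]; simp
    · have := H2 (a n) h0 b (B.filter (fun m => b m ≤ a n)) (fun m => n - m)
        (fun x y h => by simpa using h) (fun n _ => hb n) (fun n hn => (Finset.mem_filter.1 hn).2)
        ((Finset.sum_le_sum_of_subset_of_nonneg (Finset.filter_subset _ _) (fun n _ _ => hb n)).trans hB)
      calc _ = a n ^ (1 / 4 : ℝ) * ∑ m ∈ B with b m ≤ a n, b m ^ (7 / 8 : ℝ) * br (n - m) ^ (-(7 / 8) : ℝ) := by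
            rw [Finset.mul_sum]; exact Finset.sum_congr rfl fun n _ => by ring
        _ ≤ a n ^ (1 / 4 : ℝ) * (C2 * a n ^ (7 / 8 - 1 / 8 : ℝ)) := by gcongr
        _ = C2 * a n := by
            rw [mul_left_comm, ← Real.rpow_add h0]; norm_num

/-- Hardy–Littlewood–Sobolev, `ℓ⁴ → ℓ⁸`. -/
lemma hls_W : ∃ C > 0, ∀ (x : ℤ → ℝ) (A B : Finset ℤ) (X : ℝ), (∀ n, 0 ≤ x n) → 0 < X →
    ∑ n ∈ A, x n ^ 4 ≤ X ^ 4 →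
    ∑ m ∈ B, (∑ n ∈ A, x n * br (n - m) ^ (-(7 / 8) : ℝ)) ^ 8 ≤ (C * X) ^ 8 := by
  obtain ⟨C, hC, H⟩ := hls_norm
  refine ⟨C, hC, fun x A B X hx hX hA => ?_⟩
  set W : ℤ → ℝ := fun m => ∑ n ∈ A, x n * br (n - m) ^ (-(7 / 8) : ℝ) with hW
  have hW0 : ∀ m, 0 ≤ W m := fun m => Finset.sum_nonneg fun n _ =>
    mul_nonneg (hx n) (Real.rpow_nonneg (br_pos _).le _)
  set Z := ∑ m ∈ B, W m ^ 8 with hZ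
  have hZ0 : 0 ≤ Z := Finset.sum_nonneg fun m _ => by positivity
  rcases hZ0.eq_or_lt with h0 | h0
  · rw [← h0]; positivity
  have h := H (fun n => (x n / X) ^ 4) (fun m => W m ^ 8 / Z) A B (fun n => by have := hx n; positivity)
    (fun m => by positivity) (by
      simp only [div_pow]; rw [← Finset.sum_div, div_le_one (by positivity)]; exact hA)
    (by rw [← Finset.sum_div, ← hZ, div_self h0.ne'])
  have e1 : ∀ n, ((x n / X) ^ 4) ^ (1 / 4 : ℝ) = x n / X := by
    intro n
    have : 0 ≤ x n / X := by have := hx n; positivity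
    rw [← Real.rpow_natCast, ← Real.rpow_mul this]; norm_num
  have e2 : ∀ m, (W m ^ 8 / Z) ^ (7 / 8 : ℝ) = W m ^ 7 / Z ^ (7 / 8 : ℝ) := by
    intro m
    rw [Real.div_rpow (by positivity) hZ0]
    congr 1
    rw [← Real.rpow_natCast, ← Real.rpow_mul (hW0 m), ← Real.rpow_natCast]; norm_num
  simp only [e1, e2] at h
  have e3 : ∑ n ∈ A, ∑ m ∈ B, x n / X * (W m ^ 7 / Z ^ (7 / 8 : ℝ)) * br (n - m) ^ (-(7 / 8) : ℝ)
     = (∑ m ∈ B, W m ^ 8) / (X * Z ^ (7 / 8 : ℝ)) := by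
    rw [Finset.sum_comm, Finset.sum_div]
    refine Finset.sum_congr rfl fun m _ => ?_
    calc _ = (W m ^ 7 / (X * Z ^ (7 / 8 : ℝ))) * ∑ n ∈ A, x n * br (n - m) ^ (-(7 / 8) : ℝ) := by
          rw [Finset.mul_sum]; refine Finset.sum_congr rfl fun n _ => ?_
          field_simp
      _ = (W m ^ 7 / (X * Z ^ (7 / 8 : ℝ))) * W m := rfl
      _ = _ := by ring
  rw [e3, ← hZ, div_le_iff₀ (by positivity)] at h
  have e4 : Z = Z ^ (1 / 8 : ℝ) * Z ^ (7 / 8 : ℝ) := by rw [← Real.rpow_add h0]; norm_num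
  have h5 : Z ^ (1 / 8 : ℝ) ≤ C * X := by
    have p : 0 < Z ^ (7 / 8 : ℝ) := by positivity
    nth_rewrite 1 [e4] at h
    rw [← mul_assoc] at h
    exact le_of_mul_le_mul_right h p
  calc Z = (Z ^ (1 / 8 : ℝ)) ^ 8 := by rw [← Real.rpow_natCast, ← Real.rpow_mul hZ0]; norm_num
    _ ≤ (C * X) ^ 8 := by gcongr

lemma holder_bd' {ι : Type*} (F : Finset ι) (x y : ι → ℝ) (p q A B : ℝ) (hp : 1 < p)
    (hpq : p⁻¹ + q⁻¹ = 1) (hA0 : 0 ≤ A) (hB0 : 0 ≤ B)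
    (hx : ∀ i ∈ F, 0 ≤ x i) (hy : ∀ i ∈ F, 0 ≤ y i)
    (hA : ∑ i ∈ F, x i ^ p ≤ A ^ p) (hB : ∑ i ∈ F, y i ^ q ≤ B ^ q) :
    ∑ i ∈ F, x i * y i ≤ A * B := by
  have hc : p.HolderConjugate q := (Real.holderConjugate_iff).2 ⟨hp, hpq⟩
  have h := holder_bd F x y p q (A ^ p) (B ^ q) hp hpq hx hy hA hB
  rwa [← Real.rpow_mul hA0, ← Real.rpow_mul hB0, mul_one_div_cancel hc.pos.ne',
    mul_one_div_cancel hc.symm.pos.ne', Real.rpow_one, Real.rpow_one] at h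

lemma wH {ι : Type*} (F : Finset ι) (W w : ι → ℝ) (P B r : ℝ) (hr0 : 0 < r) (hr : r < 8)
    (hP : 0 ≤ P) (hB0 : 0 ≤ B) (hW : ∀ i ∈ F, 0 ≤ W i) (hw : ∀ i ∈ F, 0 ≤ w i)
    (hA : ∑ i ∈ F, W i ^ (8 : ℝ) ≤ P ^ (8 : ℝ)) (hB : ∑ i ∈ F, w i ^ (8 / (8 - r)) ≤ B ^ (8 / (8 - r))) :
    ∑ i ∈ F, W i ^ r * w i ≤ P ^ r * B := by
  have h8 : 0 < 8 - r := by linarith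
  have e : r * (8 / r) = 8 := by field_simp
  apply holder_bd' F (fun i => W i ^ r) w (8 / r) (8 / (8 - r)) (P ^ r) B
    (by rw [lt_div_iff₀ hr0]; linarith) (by field_simp; ring) (by positivity) hB0
    (fun i hi => Real.rpow_nonneg (hW i hi) _) hw _ hB
  rw [← Real.rpow_mul hP, e]
  refine le_trans (le_of_eq (Finset.sum_congr rfl fun i hi => ?_)) hA
  rw [← Real.rpow_mul (hW i hi), e]

lemma const_le {K c t : ℝ} (p : ℝ) (hK : 1 ≤ K) (hc : c ≤ K) (ht : 0 ≤ t) (hp : 1 ≤ p) :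
    c * t ^ p ≤ (K * t) ^ p := by
  rw [Real.mul_rpow (by linarith) ht]
  have : K ^ (1 : ℝ) ≤ K ^ p := Real.rpow_le_rpow_of_exponent_le hK hp
  rw [Real.rpow_one] at this
  have h2 : 0 ≤ t ^ p := by positivity
  nlinarith

lemma const_le' {K t Q : ℝ} (p : ℝ) (hK : 1 ≤ K) (ht : 0 ≤ t) (hQ : 0 ≤ Q) (hp : 1 ≤ p) :
    Q ^ p * (K * t ^ p) ≤ (Q * K * t) ^ p := by
  have := const_le p hK le_rfl ht hp
  rw [mul_assoc Q, Real.mul_rpow hQ (by positivity)]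
  gcongr

set_option maxHeartbeats 2000000 in
/-- The Hedberg-type core estimate. -/
lemma hedberg (c0 : ℝ) (hc0 : 0 ≤ c0) : ∃ C > 0, ∀ (d y W : ℤ → ℝ) (z S ρ P : ℝ) (F : Finset ℤ),
    (∀ k, 0 ≤ d k) → (∀ k, 0 ≤ y k) → (∀ k, 0 ≤ W k) → 0 ≤ z → 0 ≤ S → 0 < ρ → 0 ≤ P →
    (∀ k, d k ≤ y k + z) → (∀ k, y k ≤ d k + z) → z ≤ c0 * (S * ρ ^ (3 : ℝ)) →
    (∑ k ∈ F, d k ^ (2 : ℝ) * br k ^ (-(7 / 4) : ℝ) ≤ S ^ (2 : ℝ)) →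
    (∑ k ∈ F, y k ^ (8 : ℝ) ≤ (S * ρ ^ (4 : ℝ)) ^ (8 : ℝ)) →
    (∑ k ∈ F, W k ^ (8 : ℝ) ≤ P ^ (8 : ℝ)) →
    ∑ k ∈ F, br k ^ (-(9 / 8) : ℝ) * d k * (y k + z) * W k ≤ C * (S ^ (2 : ℝ) * ρ ^ (4 : ℝ) * P) := by
  obtain ⟨C0, hC0, H0⟩ := near_sum 0 (by norm_num) (by norm_num)
  obtain ⟨C1, hC1, H1⟩ := near_sum (2 / 3) (by norm_num) (by norm_num)
  obtain ⟨C2, hC2, H2⟩ := far_sum (9 / 5) (by norm_num)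
  obtain ⟨C3, hC3, H3⟩ := far_sum (9 / 7) (by norm_num)
  set K := 1 + C0 + C1 + C2 + C3 with hK
  have hK1 : 1 ≤ K := by linarith
  have hK0 : 0 ≤ K := by linarith
  refine ⟨2 * c0 * K + 2 * K * (1 + c0 ^ 2) + (2 * K + 2 * c0 ^ 2 * K), by positivity, ?_⟩
  intro d y W z S ρ P F hd hy hW hz hS hρ hP hdy hyd hzc hSd hSy hSW
  have hb : ∀ k, 0 ≤ br k := fun k => (br_pos k).le
  set Fn := F.filter (fun k => br k ≤ ρ ^ (8 : ℝ)) with hFn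
  set Ff := F.filter (fun k => ¬ br k ≤ ρ ^ (8 : ℝ)) with hFf
  have hR : 0 < ρ ^ (8 : ℝ) := by positivity
  have n0 := H0 _ hR F
  have n1 := H1 _ hR F
  have f2 := H2 _ hR F
  have f3 := H3 _ hR F
  rw [← hFn] at n0 n1
  rw [← hFf] at f2 f3
  rw [← Real.rpow_mul hρ.le] at n0 n1 f2 f3
  norm_num at n0 n1 f2 f3
  have sub : ∀ (G : Finset ℤ), G ⊆ F → ∀ φ : ℤ → ℝ, (∀ k, 0 ≤ φ k) → ∀ B, ∑ k ∈ F, φ k ≤ B → ∑ k ∈ G, φ k ≤ B :=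
    fun G hG φ hφ B h => (Finset.sum_le_sum_of_subset_of_nonneg hG (fun k _ _ => hφ k)).trans h
  have sn : Fn ⊆ F := Finset.filter_subset _ _
  have sf : Ff ⊆ F := Finset.filter_subset _ _
  have p8 : ∀ φ : ℤ → ℝ, (∀ k, 0 ≤ φ k) → ∀ k, 0 ≤ φ k ^ (8 : ℝ) := fun φ h k => Real.rpow_nonneg (h k) _
  have hdn := sub Fn sn _ (fun k => by have := hd k; have := hb k; positivity) _ hSd
  have hyn := sub Fn sn _ (p8 y hy) _ hSy
  have hyf := sub Ff sf _ (p8 y hy) _ hSy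
  have hWn := sub Fn sn _ (p8 W hW) _ hSW
  have hWf := sub Ff sf _ (p8 W hW) _ hSW
  -- N1
  have N1 : ∑ k ∈ Fn, (d k * br k ^ (-(7 / 8) : ℝ)) * (br k ^ (-(1 / 4) : ℝ) * W k) ≤ S * (P * K * ρ) := by
    apply holder_bd' Fn _ _ 2 2 S (P * K * ρ) (by norm_num) (by norm_num) hS (by positivity)
      (fun k _ => by have := hd k; have := hb k; positivity) (fun k _ => by have := hW k; have := hb k; positivity)
    · refine le_trans (le_of_eq (Finset.sum_congr rfl fun k _ => ?_)) hdn
      rw [Real.mul_rpow (hd k) (Real.rpow_nonneg (hb k) _), ← Real.rpow_mul (hb k)]; norm_num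
    · have := wH Fn W (fun k => br k ^ (-(1 / 2) : ℝ)) P (K * ρ ^ (2 : ℝ)) 2 (by norm_num) (by norm_num) hP
        (by positivity) (fun k _ => hW k) (fun k _ => Real.rpow_nonneg (hb k) _) hWn ?_
      · refine le_trans (le_of_eq (Finset.sum_congr rfl fun k _ => ?_)) (this.trans ?_)
        · rw [Real.mul_rpow (Real.rpow_nonneg (hb k) _) (hW k), ← Real.rpow_mul (hb k), mul_comm]; norm_num
        · exact const_le' 2 hK1 hρ.le hP (by norm_num)
      · refine le_trans (le_of_eq (Finset.sum_congr rfl fun k _ => ?_)) (n1.trans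
          (le_trans (le_of_eq ?_) (const_le (c := C1) _ hK1 (by linarith) (by positivity) (by norm_num))))
        · rw [← Real.rpow_mul (hb k)]; norm_num
        · rw [← Real.rpow_mul hρ.le]; norm_num
  -- N2
  have A1 : ∑ k ∈ Fn, W k ^ (4 : ℝ) * 1 ≤ P ^ (4 : ℝ) * (K * ρ ^ (4 : ℝ)) := by
    apply wH Fn W (fun k => 1) P (K * ρ ^ (4 : ℝ)) 4 (by norm_num) (by norm_num) hP
        (by positivity) (fun k _ => hW k) (fun k _ => by norm_num) hWn
    refine le_trans (le_of_eq ?_) (n0.trans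
          (le_trans (le_of_eq ?_) (const_le (c := C0) _ hK1 (by linarith) (by positivity) (by norm_num))))
    · simp
    · rw [← Real.rpow_mul hρ.le]; norm_num
  have A2 : ∑ k ∈ Fn, W k ^ (16 / 3 : ℝ) * 1 ≤ P ^ (16 / 3 : ℝ) * (K * ρ ^ (8 / 3 : ℝ)) := by
    apply wH Fn W (fun k => 1) P _ (16 / 3) (by norm_num) (by norm_num) hP
        (by positivity) (fun k _ => hW k) (fun k _ => by norm_num) hWn
    refine le_trans (le_of_eq ?_) (n0.trans
          (le_trans (le_of_eq ?_) (const_le (c := C0) _ hK1 (by linarith) (by positivity) (by norm_num))))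
    · simp
    · rw [← Real.rpow_mul hρ.le]; norm_num
  have A3 : ∑ k ∈ Fn, y k ^ (2 : ℝ) * W k ^ (4 : ℝ) ≤ (S * ρ ^ (4 : ℝ)) ^ (2 : ℝ) * (P ^ (4 : ℝ) * K * ρ ^ (2 : ℝ)) := by
    apply wH Fn y (fun k => W k ^ (4 : ℝ)) _ _ 2 (by norm_num) (by norm_num) (by positivity)
        (by positivity) (fun k _ => hy k) (fun k _ => by have := hW k; positivity) hyn
    refine le_trans (le_of_eq (Finset.sum_congr rfl fun k _ => ?_)) (A2.trans
      (le_trans (le_of_eq ?_) (const_le' (8 / (8 - 2)) hK1 (by positivity) (by positivity) (by norm_num))))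
    · rw [← Real.rpow_mul (hW k)]; norm_num
    · rw [← Real.rpow_mul hρ.le, ← Real.rpow_mul hP]; norm_num
  have N2 : ∑ k ∈ Fn, (d k ^ (3 / 2 : ℝ) * br k ^ (-(21 / 16) : ℝ)) *
      (br k ^ (3 / 16 : ℝ) * (y k + z) ^ (1 / 2 : ℝ) * W k) ≤ S ^ (3 / 2 : ℝ) *
      (2 * K * (1 + c0 ^ 2) * (P * S ^ (1 / 2 : ℝ) * ρ ^ (4 : ℝ))) := by
    have hyz : ∀ k, 0 ≤ y k + z := fun k => add_nonneg (hy k) hz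
    apply holder_bd' Fn _ _ (4 / 3) 4 _ _ (by norm_num) (by norm_num) (by positivity) (by positivity)
      (fun k _ => by have := hd k; have := hb k; positivity)
      (fun k _ => by have := hW k; have := hb k; have := hyz k; positivity)
    · refine le_trans (le_of_eq (Finset.sum_congr rfl fun k _ => ?_)) (hdn.trans (le_of_eq ?_))
      · rw [Real.mul_rpow (Real.rpow_nonneg (hd k) _) (Real.rpow_nonneg (hb k) _), ← Real.rpow_mul (hb k),
          ← Real.rpow_mul (hd k)]; norm_num
      · rw [← Real.rpow_mul hS]; norm_num
    · calc _ ≤ ∑ k ∈ Fn, ρ ^ (6 : ℝ) * (2 * (y k ^ (2 : ℝ) * W k ^ (4 : ℝ)) + 2 * z ^ (2 : ℝ) * (W k ^ (4 : ℝ) * 1)) := by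
            apply Finset.sum_le_sum
            intro k hk
            have hk : br k ≤ ρ ^ (8 : ℝ) := (Finset.mem_filter.1 hk).2
            have b1 : (br k ^ (3 / 16 : ℝ)) ^ (4 : ℝ) ≤ ρ ^ (6 : ℝ) := by
              calc _ = br k ^ (3 / 4 : ℝ) := by rw [← Real.rpow_mul (hb k)]; norm_num
                _ ≤ (ρ ^ (8 : ℝ)) ^ (3 / 4 : ℝ) := Real.rpow_le_rpow (hb k) hk (by norm_num)
                _ = _ := by rw [← Real.rpow_mul hρ.le]; norm_num
            have b2 : ((y k + z) ^ (1 / 2 : ℝ)) ^ (4 : ℝ) ≤ 2 * y k ^ (2 : ℝ) + 2 * z ^ (2 : ℝ) := by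
              rw [← Real.rpow_mul (hyz k)]
              norm_num
              nlinarith [sq_nonneg (y k - z)]
            have hWk := hW k
            have hbk := hb k
            have hyk := hyz k
            rw [Real.mul_rpow (by positivity) hWk, Real.mul_rpow (by positivity) (by positivity)]
            calc _ ≤ ρ ^ (6 : ℝ) * (2 * y k ^ (2 : ℝ) + 2 * z ^ (2 : ℝ)) * W k ^ (4 : ℝ) := by gcongr
              _ = _ := by ring
        _ = ρ ^ (6 : ℝ) * (2 * ∑ k ∈ Fn, (y k ^ (2 : ℝ) * W k ^ (4 : ℝ)) + 2 * z ^ (2 : ℝ) * ∑ k ∈ Fn, (W k ^ (4 : ℝ) * 1)) := by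
            rw [← Finset.mul_sum, Finset.sum_add_distrib, ← Finset.mul_sum, ← Finset.mul_sum]
        _ ≤ ρ ^ (6 : ℝ) * (2 * ((S * ρ ^ (4 : ℝ)) ^ (2 : ℝ) * (P ^ (4 : ℝ) * K * ρ ^ (2 : ℝ))) +
              2 * (c0 * (S * ρ ^ (3 : ℝ))) ^ (2 : ℝ) * (P ^ (4 : ℝ) * (K * ρ ^ (4 : ℝ)))) := by
            gcongr
            exact Finset.sum_nonneg fun k _ => by have := hW k; positivity
        _ = (2 * K * (1 + c0 ^ 2)) * (P * S ^ (1 / 2 : ℝ) * ρ ^ (4 : ℝ)) ^ (4 : ℝ) := by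
            have : S ^ 2 = (S ^ (1 / 2 : ℝ)) ^ 4 := by
              rw [← Real.rpow_natCast, ← Real.rpow_natCast, ← Real.rpow_mul hS]; norm_num
            norm_num
            simp only [mul_pow, this]
            norm_num
            ring
        _ ≤ _ := by
            apply const_le _ _ le_rfl (by positivity) (by norm_num)
            nlinarith [sq_nonneg c0]
  -- far
  have G1 : ∑ k ∈ Ff, W k ^ (4 / 3 : ℝ) * br k ^ (-(3 / 2) : ℝ) ≤ P ^ (4 / 3 : ℝ) * (K * ρ ^ (-(16 / 3) : ℝ)) := by
    apply wH Ff W _ P _ (4 / 3) (by norm_num) (by norm_num) hP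
        (by positivity) (fun k _ => hW k) (fun k _ => by have := hb k; positivity) hWf
    refine le_trans (le_of_eq (Finset.sum_congr rfl fun k _ => ?_)) (f2.trans
          (le_trans (le_of_eq ?_) (const_le (c := C2) _ hK1 (by linarith) (by positivity) (by norm_num))))
    · rw [← Real.rpow_mul (hb k)]; norm_num
    · rw [← Real.rpow_mul hρ.le]; norm_num
  have G2 : ∑ k ∈ Ff, y k ^ (2 : ℝ) * (br k ^ (-(9 / 8) : ℝ) * W k) ≤
      (S * ρ ^ (4 : ℝ)) ^ (2 : ℝ) * (P * K * ρ ^ (-4 : ℝ)) := by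
    apply wH Ff y _ _ _ 2 (by norm_num) (by norm_num) (by positivity)
        (by positivity) (fun k _ => hy k) (fun k _ => by have := hW k; have := hb k; positivity) hyf
    refine le_trans (le_of_eq (Finset.sum_congr rfl fun k _ => ?_)) (G1.trans
      (le_trans (le_of_eq ?_) (const_le' (8 / (8 - 2)) hK1 (by positivity) (by positivity) (by norm_num))))
    · rw [Real.mul_rpow (Real.rpow_nonneg (hb k) _) (hW k), ← Real.rpow_mul (hb k), mul_comm]; norm_num
    · rw [← Real.rpow_mul hρ.le]; norm_num
  have G3 : ∑ k ∈ Ff, W k ^ (1 : ℝ) * br k ^ (-(9 / 8) : ℝ) ≤ P ^ (1 : ℝ) * (K * ρ ^ (-2 : ℝ)) := by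
    apply wH Ff W _ P _ 1 (by norm_num) (by norm_num) hP
        (by positivity) (fun k _ => hW k) (fun k _ => by have := hb k; positivity) hWf
    refine le_trans (le_of_eq (Finset.sum_congr rfl fun k _ => ?_)) (f3.trans
          (le_trans (le_of_eq ?_) (const_le (c := C3) _ hK1 (by linarith) (by positivity) (by norm_num))))
    · rw [← Real.rpow_mul (hb k)]; norm_num
    · rw [← Real.rpow_mul hρ.le]; norm_num
  -- assemble
  have r43 : ρ ^ (4 : ℝ) = ρ ^ (3 : ℝ) * ρ := by
    rw [← Real.rpow_add_one hρ.ne']; norm_num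
  have nearB : ∑ k ∈ Fn, br k ^ (-(9 / 8) : ℝ) * d k * (y k + z) * W k ≤
      (2 * c0 * K + 2 * K * (1 + c0 ^ 2)) * (S ^ (2 : ℝ) * ρ ^ (4 : ℝ) * P) := by
    calc _ ≤ ∑ k ∈ Fn, (2 * z * ((d k * br k ^ (-(7 / 8) : ℝ)) * (br k ^ (-(1 / 4) : ℝ) * W k)) +
          (d k ^ (3 / 2 : ℝ) * br k ^ (-(21 / 16) : ℝ)) *
            (br k ^ (3 / 16 : ℝ) * (y k + z) ^ (1 / 2 : ℝ) * W k)) := by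
          apply Finset.sum_le_sum
          intro k _
          have hWk := hW k
          have hbk := hb k
          have hyk := hy k
          have hdk := hd k
          have e1 : br k ^ (-(7 / 8) : ℝ) * br k ^ (-(1 / 4) : ℝ) = br k ^ (-(9 / 8) : ℝ) := by
            rw [← Real.rpow_add (br_pos k)]; norm_num
          have e2 : br k ^ (-(21 / 16) : ℝ) * br k ^ (3 / 16 : ℝ) = br k ^ (-(9 / 8) : ℝ) := by
            rw [← Real.rpow_add (br_pos k)]; norm_num
          have e3 : d k * d k ≤ d k ^ (3 / 2 : ℝ) * (y k + z) ^ (1 / 2 : ℝ) := by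
            calc d k * d k = d k ^ (3 / 2 : ℝ) * d k ^ (1 / 2 : ℝ) := by
                  rw [← Real.rpow_add' hdk (by norm_num)]; norm_num; ring
              _ ≤ _ := by
                gcongr; exact hdy k
          have e4 : d k * (y k + z) ≤ 2 * z * d k + d k ^ (3 / 2 : ℝ) * (y k + z) ^ (1 / 2 : ℝ) := by
            nlinarith [hyd k]
          calc _ = (br k ^ (-(9 / 8) : ℝ) * W k) * (d k * (y k + z)) := by ring
            _ ≤ (br k ^ (-(9 / 8) : ℝ) * W k) * (2 * z * d k + d k ^ (3 / 2 : ℝ) * (y k + z) ^ (1 / 2 : ℝ)) := by gcongr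
            _ = 2 * z * (d k * (br k ^ (-(9 / 8) : ℝ)) * W k) + (d k ^ (3 / 2 : ℝ) * br k ^ (-(9 / 8) : ℝ)) *
                ((y k + z) ^ (1 / 2 : ℝ) * W k) := by ring
            _ = _ := by nth_rewrite 1 [← e1]; rw [← e2]; ring
      _ ≤ 2 * (c0 * (S * ρ ^ (3 : ℝ))) * (S * (P * K * ρ)) + S ^ (3 / 2 : ℝ) *
            (2 * K * (1 + c0 ^ 2) * (P * S ^ (1 / 2 : ℝ) * ρ ^ (4 : ℝ))) := by
          rw [Finset.sum_add_distrib, ← Finset.mul_sum]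
          gcongr
          exact Finset.sum_nonneg fun k _ => by have := hW k; have := hb k; have := hd k; positivity
      _ = _ := by
          have : S ^ (2 : ℝ) = S ^ (3 / 2 : ℝ) * S ^ (1 / 2 : ℝ) := by
            rw [← Real.rpow_add' hS (by norm_num)]; norm_num
          have h2 : S ^ (2 : ℝ) = S * S := by norm_num; ring
          calc _ = 2 * c0 * K * ((S * S) * (ρ ^ (3 : ℝ) * ρ) * P) + 2 * K * (1 + c0 ^ 2) *
                ((S ^ (3 / 2 : ℝ) * S ^ (1 / 2 : ℝ)) * ρ ^ (4 : ℝ) * P) := by ring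
            _ = _ := by rw [← this, ← h2, ← r43]; ring
  have farB : ∑ k ∈ Ff, br k ^ (-(9 / 8) : ℝ) * d k * (y k + z) * W k ≤
      (2 * K + 2 * c0 ^ 2 * K) * (S ^ (2 : ℝ) * ρ ^ (4 : ℝ) * P) := by
    calc _ ≤ ∑ k ∈ Ff, (2 * (y k ^ (2 : ℝ) * (br k ^ (-(9 / 8) : ℝ) * W k)) +
            2 * z ^ (2 : ℝ) * (W k ^ (1 : ℝ) * br k ^ (-(9 / 8) : ℝ))) := by
          apply Finset.sum_le_sum
          intro k _
          have hWk := hW k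
          have hbk := hb k
          have hyk := hy k
          have hdk := hd k
          have e4 : d k * (y k + z) ≤ 2 * y k ^ (2 : ℝ) + 2 * z ^ (2 : ℝ) := by
            norm_num
            nlinarith [hdy k, sq_nonneg (y k - z)]
          calc _ = (br k ^ (-(9 / 8) : ℝ) * W k) * (d k * (y k + z)) := by ring
            _ ≤ (br k ^ (-(9 / 8) : ℝ) * W k) * (2 * y k ^ (2 : ℝ) + 2 * z ^ (2 : ℝ)) := by gcongr
            _ = _ := by rw [Real.rpow_one]; ring
      _ ≤ 2 * ((S * ρ ^ (4 : ℝ)) ^ (2 : ℝ) * (P * K * ρ ^ (-4 : ℝ))) + 2 * (c0 * (S * ρ ^ (3 : ℝ))) ^ (2 : ℝ) *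
            (P ^ (1 : ℝ) * (K * ρ ^ (-2 : ℝ))) := by
          rw [Finset.sum_add_distrib, ← Finset.mul_sum, ← Finset.mul_sum]
          gcongr
          exact Finset.sum_nonneg fun k _ => by have := hW k; have := hb k; have := hd k; positivity
      _ = _ := by
          have q1 : ρ ^ (-4 : ℝ) = (ρ ^ 4)⁻¹ := by rw [Real.rpow_neg hρ.le]; norm_num
          have q2 : ρ ^ (-2 : ℝ) = (ρ ^ 2)⁻¹ := by rw [Real.rpow_neg hρ.le]; norm_num
          rw [q1, q2]
          norm_num
          field_simp
  calc _ = ∑ k ∈ Fn, br k ^ (-(9 / 8) : ℝ) * d k * (y k + z) * W k + ∑ k ∈ Ff, br k ^ (-(9 / 8) : ℝ) * d k * (y k + z) * W k :=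
        (Finset.sum_filter_add_sum_filter_not F _ _).symm
    _ ≤ _ := by linarith

lemma sob_R (d y : ℤ → ℝ) (z S N : ℝ) (hd : ∀ k, 0 ≤ d k) (hy : ∀ k, 0 ≤ y k)
    (hS : 0 ≤ S) (hN : 0 ≤ N) (hz : ∀ k, z ≤ y k + d k) (hzN : z ≤ N)
    (hdS : ∀ F : Finset ℤ, ∑ k ∈ F, d k ^ (2 : ℝ) * br k ^ (-(7 / 4) : ℝ) ≤ S ^ (2 : ℝ))
    (hyN : ∀ F : Finset ℤ, ∑ k ∈ F, y k ^ (8 : ℝ) ≤ N ^ (8 : ℝ)) (R : ℝ) (hR : 0 < R) :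
    z ≤ 2 * (R ^ (3 / 8 : ℝ) * S + R ^ (-(1 / 8) : ℝ) * N) := by
  have hR0 : 0 ≤ R ^ (3 / 8 : ℝ) * S := by positivity
  rcases lt_or_ge R 1 with h1 | h1
  · have : 1 ≤ R ^ (-(1 / 8) : ℝ) := Real.one_le_rpow_of_pos_of_le_one_of_nonpos hR h1.le (by norm_num)
    nlinarith
  set M := ⌊R⌋₊ with hM
  have hM1 : 1 ≤ M := Nat.one_le_floor_iff _ |>.2 h1
  have hM1' : (1 : ℝ) ≤ M := by exact_mod_cast hM1
  have hMR : (M : ℝ) ≤ R := Nat.floor_le hR.le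
  have hRM : R ≤ 2 * M := by have := Nat.lt_floor_add_one R; linarith
  have hM0 : (0 : ℝ) < M := by linarith
  set F : Finset ℤ := (Finset.range M).image (fun j : ℕ => (j : ℤ)) with hF
  have hcard : F.card = M := by
    rw [hF, Finset.card_image_of_injective _ Nat.cast_injective, Finset.card_range]
  have hbr : ∀ k ∈ F, br k ≤ M := by
    intro k hk
    simp only [hF, Finset.mem_image, Finset.mem_range] at hk
    obtain ⟨j, hj, rfl⟩ := hk
    rw [br_natAbs]; simp; exact_mod_cast hj
  have s1 : ∑ k ∈ F, (d k * br k ^ (-(7 / 8) : ℝ)) * br k ^ (7 / 8 : ℝ) ≤ S * (M : ℝ) ^ (11 / 8 : ℝ) := by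
    apply holder_bd' F _ _ 2 2 _ _ (by norm_num) (by norm_num) hS (by positivity)
    · intro k _; have := hd k; have := br_pos k; positivity
    · intro k _; have := br_pos k; positivity
    · refine le_trans (le_of_eq ?_) (hdS F)
      refine Finset.sum_congr rfl fun k _ => ?_
      rw [Real.mul_rpow (hd k) (by have := br_pos k; positivity), ← Real.rpow_mul (br_pos k).le]
      norm_num
    · calc _ ≤ ∑ k ∈ F, (M : ℝ) ^ (7 / 4 : ℝ) := by
            apply Finset.sum_le_sum
            intro k hk
            rw [← Real.rpow_mul (br_pos k).le]
            norm_num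
            exact Real.rpow_le_rpow (br_pos k).le (hbr k hk) (by norm_num)
        _ = (M : ℝ) ^ (1 : ℝ) * (M : ℝ) ^ (7 / 4 : ℝ) := by simp [hcard]
        _ ≤ _ := by rw [← Real.rpow_add hM0, ← Real.rpow_mul hM0.le]; norm_num
  have s2 : ∑ k ∈ F, y k * 1 ≤ N * (M : ℝ) ^ (7 / 8 : ℝ) := by
    apply holder_bd' F _ _ 8 (8 / 7) _ _ (by norm_num) (by norm_num) hN (by positivity)
    · intro k _; exact hy k
    · intro k _; norm_num
    · exact hyN F
    · rw [← Real.rpow_mul hM0.le]; simp [hcard]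
  have s3 : (M : ℝ) * z ≤ S * (M : ℝ) ^ (11 / 8 : ℝ) + N * (M : ℝ) ^ (7 / 8 : ℝ) := by
    calc (M : ℝ) * z = ∑ k ∈ F, z := by simp [hcard]
      _ ≤ ∑ k ∈ F, (d k + y k) := Finset.sum_le_sum fun k _ => by linarith [hz k]
      _ = ∑ k ∈ F, (d k * br k ^ (-(7 / 8) : ℝ)) * br k ^ (7 / 8 : ℝ) + ∑ k ∈ F, y k * 1 := by
          rw [← Finset.sum_add_distrib]
          refine Finset.sum_congr rfl fun k _ => ?_
          rw [mul_assoc, ← Real.rpow_add (br_pos k)]; norm_num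
      _ ≤ _ := add_le_add s1 s2
  have s4 : z ≤ (M : ℝ) ^ (3 / 8 : ℝ) * S + (M : ℝ) ^ (-(1 / 8) : ℝ) * N := by
    have e1 : (M : ℝ) ^ (11 / 8 : ℝ) = M * (M : ℝ) ^ (3 / 8 : ℝ) := by
      rw [← Real.rpow_one_add' hM0.le (by norm_num)]; norm_num
    have e2 : (M : ℝ) ^ (7 / 8 : ℝ) = M * (M : ℝ) ^ (-(1 / 8) : ℝ) := by
      rw [← Real.rpow_one_add' hM0.le (by norm_num)]; norm_num
    rw [e1, e2] at s3
    refine le_of_mul_le_mul_left ?_ hM0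
    linarith
  have s5 : (M : ℝ) ^ (3 / 8 : ℝ) ≤ R ^ (3 / 8 : ℝ) := Real.rpow_le_rpow hM0.le hMR (by norm_num)
  have s6 : (M : ℝ) ^ (-(1 / 8) : ℝ) ≤ 2 * R ^ (-(1 / 8) : ℝ) := by
    calc (M : ℝ) ^ (-(1 / 8) : ℝ) ≤ (R / 2) ^ (-(1 / 8) : ℝ) :=
          Real.rpow_le_rpow_of_nonpos (by positivity) (by linarith) (by norm_num)
      _ = (1 / 2 : ℝ) ^ (-(1 / 8) : ℝ) * R ^ (-(1 / 8) : ℝ) := by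
          rw [← Real.mul_rpow (by norm_num) hR.le]; congr 1; ring
      _ ≤ _ := by
          gcongr
          calc (1 / 2 : ℝ) ^ (-(1 / 8) : ℝ) ≤ (1 / 2 : ℝ) ^ (-1 : ℝ) :=
                Real.rpow_le_rpow_of_exponent_ge (by norm_num) (by norm_num) (by norm_num)
            _ = 2 := by rw [Real.rpow_neg_one]; norm_num
  calc z ≤ _ := s4
    _ ≤ R ^ (3 / 8 : ℝ) * S + (2 * R ^ (-(1 / 8) : ℝ)) * N := by gcongr
    _ ≤ _ := by nlinarith

lemma sob_rho (d y : ℤ → ℝ) (z S N ρ : ℝ) (hd : ∀ k, 0 ≤ d k) (hy : ∀ k, 0 ≤ y k)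
    (hS : 0 ≤ S) (hN : 0 ≤ N) (hz : ∀ k, z ≤ y k + d k) (hzN : z ≤ N)
    (hdS : ∀ F : Finset ℤ, ∑ k ∈ F, d k ^ (2 : ℝ) * br k ^ (-(7 / 4) : ℝ) ≤ S ^ (2 : ℝ))
    (hyN : ∀ F : Finset ℤ, ∑ k ∈ F, y k ^ (8 : ℝ) ≤ N ^ (8 : ℝ)) (hρ : 0 < ρ)
    (hNr : N = S * ρ ^ (4 : ℝ)) : z ≤ 4 * (S * ρ ^ (3 : ℝ)) := by
  have := sob_R d y z S N hd hy hS hN hz hzN hdS hyN (ρ ^ (8 : ℝ)) (by positivity)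
  rw [← Real.rpow_mul hρ.le, ← Real.rpow_mul hρ.le, hNr] at this
  have e : ρ ^ (8 * -(1 / 8) : ℝ) * (S * ρ ^ (4 : ℝ)) = S * ρ ^ (3 : ℝ) := by
    rw [mul_left_comm, ← Real.rpow_add hρ]; norm_num
  rw [e] at this
  norm_num at this ⊢
  linarith

lemma exists_rho {S N : ℝ} (hS : 0 < S) (hN : 0 < N) : ∃ ρ > 0, N = S * ρ ^ (4 : ℝ) := by
  refine ⟨(N / S) ^ (1 / 4 : ℝ), by positivity, ?_⟩
  rw [← Real.rpow_mul (by positivity)]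
  norm_num
  field_simp

lemma sob_pt (d y : ℤ → ℝ) (z S N : ℝ) (hd : ∀ k, 0 ≤ d k) (hy : ∀ k, 0 ≤ y k) (hz0 : 0 ≤ z)
    (hS : 0 ≤ S) (hN : 0 ≤ N) (hz : ∀ k, z ≤ y k + d k) (hzN : z ≤ N)
    (hdS : ∀ F : Finset ℤ, ∑ k ∈ F, d k ^ (2 : ℝ) * br k ^ (-(7 / 4) : ℝ) ≤ S ^ (2 : ℝ))
    (hyN : ∀ F : Finset ℤ, ∑ k ∈ F, y k ^ (8 : ℝ) ≤ N ^ (8 : ℝ)) :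
    z ^ 8 ≤ 4 ^ 8 * (S ^ 2 * N ^ 6) := by
  rcases hN.eq_or_lt with h | hN'
  · have : z = 0 := by linarith
    rw [this, ← h]; norm_num
  rcases hS.eq_or_lt with h | hS'
  · have : z = 0 := by
      by_contra hne
      have hzp : 0 < z := lt_of_le_of_ne hz0 (Ne.symm hne)
      have := sob_R d y z S N hd hy hS hN hz hzN hdS hyN ((4 * N / z) ^ (8 : ℝ)) (by positivity)
      rw [← h, ← Real.rpow_mul (by positivity), ← Real.rpow_mul (by positivity)] at this
      rw [show (8 * -(1 / 8) : ℝ) = -1 by norm_num, Real.rpow_neg_one] at this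
      have e : 2 * ((4 * N / z) ^ (8 * (3 / 8) : ℝ) * 0 + (4 * N / z)⁻¹ * N) = z / 2 := by
        field_simp; ring
      rw [e] at this
      linarith
    rw [this]; norm_num; positivity
  obtain ⟨ρ, hρ, e⟩ := exists_rho hS' hN'
  have := sob_rho d y z S N ρ hd hy hS hN hz hzN hdS hyN hρ e
  calc z ^ 8 ≤ (4 * (S * ρ ^ (3 : ℝ))) ^ 8 := by gcongr
    _ = _ := by rw [e]; norm_num; ring

lemma Qlem : ∃ C > 0, ∀ (d y W : ℤ → ℝ) (z S N P : ℝ), (∀ k, 0 ≤ d k) → (∀ k, 0 ≤ y k) →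
    (∀ k, 0 ≤ W k) → 0 ≤ z → 0 ≤ S → 0 ≤ N → 0 ≤ P → (∀ k, z ≤ y k + d k) → 
    (∀ k, d k ≤ y k + z) → (∀ k, y k ≤ d k + z) → z ≤ N →
    (∀ F : Finset ℤ, ∑ k ∈ F, d k ^ (2 : ℝ) * br k ^ (-(7 / 4) : ℝ) ≤ S ^ (2 : ℝ)) →
    (∀ F : Finset ℤ, ∑ k ∈ F, y k ^ (8 : ℝ) ≤ N ^ (8 : ℝ)) →
    (∀ F : Finset ℤ, ∑ k ∈ F, W k ^ (8 : ℝ) ≤ P ^ (8 : ℝ)) → ∀ F : Finset ℤ,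
    ∑ k ∈ F, br k ^ (-(9 / 8) : ℝ) * d k * (y k + z) * W k ≤ C * (S * N * P) := by
  obtain ⟨C, hC, H⟩ := hedberg 4 (by norm_num)
  refine ⟨C, hC, ?_⟩
  intro d y W z S N P hd hy hW hz0 hS hN hP hz hdy hyd hzN hdS hyN hWP F
  have key : (∀ k, d k * (y k + z) = 0) → ∑ k ∈ F, br k ^ (-(9 / 8) : ℝ) * d k * (y k + z) * W k ≤ C * (S * N * P) := by
    intro h
    rw [Finset.sum_eq_zero (fun k _ => by rw [mul_assoc (br k ^ _), h k]; ring)]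
    positivity
  rcases hN.eq_or_lt with h | hN'
  · apply key
    intro k
    have h0 := hyN {k}
    rw [← h] at h0
    simp at h0
    have h1 := hy k
    have h2 : y k = 0 := by
      by_contra hne
      have : 0 < y k ^ 8 := by positivity
      linarith
    have : z = 0 := by linarith
    simp [this, h2]
  rcases hS.eq_or_lt with h | hS'
  · apply key
    intro k
    have h0 := hdS {k}
    rw [← h] at h0
    simp at h0
    have h1 := hd k
    have h2 : d k = 0 := by
      by_contra hne
      have := br_pos k
      have : 0 < d k ^ 2 * br k ^ (-(7 / 4) : ℝ) := by positivity
      linarith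
    simp [h2]
  obtain ⟨ρ, hρ, e⟩ := exists_rho hS' hN'
  have := sob_rho d y z S N ρ hd hy hS hN hz hzN hdS hyN hρ e
  have := H d y W z S ρ P F hd hy hW hz0 hS hρ hP hdy hyd this (hdS F) (by rw [← e]; exact hyN F) (hWP F)
  refine this.trans (le_of_eq ?_)
  rw [e, Real.rpow_two]; ring

lemma sob_full (v : ℤ → ℂ × ℂ) (A : ℝ) (hA : 0 ≤ A) (hv : Summable fun n => ‖v n‖ ^ 2)
    (hD : ∀ F1 F2 : Finset ℤ, ∑ m ∈ F1, ∑ k ∈ F2, ‖v (m + 2 * k) - v m‖ ^ 2 * br k ^ (-(7 / 4) : ℝ) ≤ A ^ 2) :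
    ∃ (S : ℤ → ℝ) (N : ℝ), (∀ m, 0 ≤ S m) ∧ 0 ≤ N ∧ N ≤ 4 ^ 4 * A ∧
      (∀ F : Finset ℤ, ∑ m ∈ F, S m ^ 2 ≤ A ^ 2) ∧
      (∀ m, ∀ F : Finset ℤ, ∑ k ∈ F, ‖v (m + 2 * k) - v m‖ ^ (2 : ℝ) * br k ^ (-(7 / 4) : ℝ) ≤ S m ^ (2 : ℝ)) ∧
      (∀ F : Finset ℤ, ∑ m ∈ F, ‖v m‖ ^ (8 : ℝ) ≤ N ^ (8 : ℝ)) := by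
  set φ : ℤ → ℤ → ℝ := fun m k => ‖v (m + 2 * k) - v m‖ ^ 2 * br k ^ (-(7 / 4) : ℝ) with hφ
  have hφ0 : ∀ m k, 0 ≤ φ m k := fun m k => by have := br_pos k; positivity
  have hs : ∀ m, Summable (φ m) := fun m => summable_of_sum_le (hφ0 m) (c := A ^ 2) fun F => by
    simpa using hD {m} F
  set S : ℤ → ℝ := fun m => √(∑' k, φ m k) with hS
  have hS0 : ∀ m, 0 ≤ S m := fun m => Real.sqrt_nonneg _
  have hS2 : ∀ m, S m ^ 2 = ∑' k, φ m k := fun m => Real.sq_sqrt (tsum_nonneg (hφ0 m))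
  have hSA : ∀ F : Finset ℤ, ∑ m ∈ F, S m ^ 2 ≤ A ^ 2 := by
    intro F
    simp_rw [hS2]
    rw [← Summable.tsum_finsetSum (fun m _ => hs m)]
    apply Real.tsum_le_of_sum_le (fun k => Finset.sum_nonneg fun m _ => hφ0 m k)
    intro F2
    rw [Finset.sum_comm]
    exact hD F F2
  have hdS : ∀ m, ∀ F : Finset ℤ, ∑ k ∈ F, ‖v (m + 2 * k) - v m‖ ^ (2 : ℝ) * br k ^ (-(7 / 4) : ℝ) ≤ S m ^ (2 : ℝ) := by
    intro m F
    simp_rw [Real.rpow_two]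
    rw [hS2]
    exact (hs m).sum_le_tsum F (fun k _ => hφ0 m k)
  have h8 : Summable fun n => ‖v n‖ ^ 8 := by
    set T := ∑' n, ‖v n‖ ^ 2
    refine Summable.of_nonneg_of_le (fun n => by positivity) (fun n => ?_) (hv.mul_left (T ^ 3))
    have : ‖v n‖ ^ 2 ≤ T := hv.le_tsum n (fun _ _ => by positivity)
    calc ‖v n‖ ^ 8 = (‖v n‖ ^ 2) ^ 3 * ‖v n‖ ^ 2 := by ring
      _ ≤ _ := by gcongr
  set N := (∑' n, ‖v n‖ ^ 8) ^ (1 / 8 : ℝ) with hN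
  have hT0 : 0 ≤ ∑' n, ‖v n‖ ^ 8 := tsum_nonneg fun n => by positivity
  have hN0 : 0 ≤ N := by positivity
  have hN8 : N ^ 8 = ∑' n, ‖v n‖ ^ 8 := by
    rw [hN, ← Real.rpow_natCast, ← Real.rpow_mul hT0]; norm_num
  have hyN : ∀ F : Finset ℤ, ∑ m ∈ F, ‖v m‖ ^ (8 : ℝ) ≤ N ^ (8 : ℝ) := by
    intro F
    have := h8.sum_le_tsum F (fun n _ => by positivity)
    rw [← hN8] at this
    simpa using this
  refine ⟨S, N, hS0, hN0, ?_, hSA, hdS, hyN⟩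
  have hpt : ∀ m, ‖v m‖ ^ 8 ≤ 4 ^ 8 * (S m ^ 2 * N ^ 6) := by
    intro m
    apply sob_pt (fun k => ‖v (m + 2 * k) - v m‖) (fun k => ‖v (m + 2 * k)‖) (‖v m‖) (S m) N
      (fun _ => norm_nonneg _) (fun _ => norm_nonneg _) (norm_nonneg _) (hS0 m) hN0 ?_ ?_ (hdS m) ?_
    · intro k
      have := norm_sub_norm_le (v m) (v (m + 2 * k))
      rw [norm_sub_rev] at this
      linarith
    · have := hyN {m}
      simp at this
      exact le_of_pow_le_pow_left₀ (by norm_num) hN0 this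
    · intro F
      have := hyN (F.image fun k => m + 2 * k)
      rwa [Finset.sum_image (fun x _ y _ hxy => by simpa using hxy)] at this
  have hfin : N ^ 8 ≤ 4 ^ 8 * (A ^ 2 * N ^ 6) := by
    rw [hN8]
    apply Real.tsum_le_of_sum_le (fun k => by positivity)
    intro F
    calc _ ≤ ∑ m ∈ F, 4 ^ 8 * (S m ^ 2 * N ^ 6) := Finset.sum_le_sum fun m _ => hpt m
      _ = 4 ^ 8 * ((∑ m ∈ F, S m ^ 2) * N ^ 6) := by rw [← Finset.mul_sum, Finset.sum_mul]
      _ ≤ _ := by gcongr; exact hSA F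
  rcases hN0.eq_or_lt with h | h
  · rw [← h]; positivity
  · have : N ^ 2 ≤ (4 ^ 4 * A) ^ 2 := by
      have h6 : 0 < N ^ 6 := by positivity
      refine le_of_mul_le_mul_right ?_ h6
      calc _ = N ^ 8 := by ring
        _ ≤ _ := hfin
        _ = _ := by ring
    exact le_of_sq_le_sq this (by positivity)

lemma ennreal_tsum_le_of_real (x : ℤ → ℝ) (hx : ∀ k, 0 ≤ x k) (B : ℝ)
    (h : ∀ F : Finset ℤ, ∑ k ∈ F, x k ≤ B) : ∑' k, ENNReal.ofReal (x k) ≤ ENNReal.ofReal B := by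
  rw [ENNReal.tsum_eq_iSup_sum]
  apply iSup_le
  intro F
  rw [← ENNReal.ofReal_sum_of_nonneg (fun k _ => hx k)]
  exact ENNReal.ofReal_le_ofReal (h F)

lemma comm_bound (c : ℝ) (hc : 0 < c) : ∃ C > 0, ∀ (K kk : ℤ → ℂ) (v : ℤ → ℂ × ℂ) (S : ℤ → ℝ) (N A U X : ℝ)
    (u : ℤ → ℂ) (w : ℤ → ℝ) (B : Finset ℤ),
    (∀ k, ‖K (2 * k)‖ ≤ c * br k ^ (-(9 / 8) : ℝ)) → (∀ k, K (2 * k + 1) = 0) →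
    (∀ n, ‖kk n‖ ≤ c * br n ^ (-(7 / 8) : ℝ)) → 
    (∀ m, 0 ≤ S m) → 0 ≤ N → 0 ≤ A → 0 ≤ U → 0 < X → (∀ n, 0 ≤ w n) →
    (∀ F : Finset ℤ, ∑ m ∈ F, S m ^ 2 ≤ A ^ 2) →
    (∀ m, ∀ F : Finset ℤ, ∑ k ∈ F, ‖v (m + 2 * k) - v m‖ ^ (2 : ℝ) * br k ^ (-(7 / 4) : ℝ) ≤ S m ^ (2 : ℝ)) →
    (∀ F : Finset ℤ, ∑ m ∈ F, ‖v m‖ ^ (8 : ℝ) ≤ N ^ (8 : ℝ)) →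
    (∀ F : Finset ℤ, ∑ m ∈ F, ‖u m‖ ^ 2 ≤ U ^ 2) →
    (∑ n ∈ B, w n ^ 4 ≤ X ^ 4) →
    ∑ n ∈ B, ENNReal.ofReal (w n) * ∑' m, ‖kk (n - m)‖ₑ * ∑' j, ‖K (m - j)‖ₑ *
      (‖(v m).1 * (v m).2 - (v j).1 * (v j).2‖ₑ * ‖u j‖ₑ) ≤ ENNReal.ofReal (C * (U * A * N * X)) := by
  obtain ⟨C1, hC1, H1⟩ := hls_W
  obtain ⟨C2, hC2, H2⟩ := Qlem
  refine ⟨c * c * C1 * C2, by positivity, ?_⟩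
  intro K kk v S N A U X u w B hK hKo hkk hS hN hA hU hX hw hSA hdS hyN hu hwX
  set W : ℤ → ℝ := fun m => ∑ n ∈ B, w n * br (n - m) ^ (-(7 / 8) : ℝ) with hWdef
  have hW0 : ∀ m, 0 ≤ W m := fun m => Finset.sum_nonneg fun n _ => by
    have := hw n; have := br_pos (n - m); positivity
  have hW8 : ∀ F : Finset ℤ, ∑ m ∈ F, W m ^ 8 ≤ (C1 * X) ^ 8 := fun F => H1 w B F X hw hX hwX
  set D : ℤ → ℤ → ENNReal := fun m j => ‖(v m).1 * (v m).2 - (v j).1 * (v j).2‖ₑ with hD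
  have step1 : ∑ n ∈ B, ENNReal.ofReal (w n) * ∑' m, ‖kk (n - m)‖ₑ * ∑' j, ‖K (m - j)‖ₑ *
      (D m j * ‖u j‖ₑ) ≤ ∑' j, ‖u j‖ₑ * ∑' m, ‖K (m - j)‖ₑ * D m j * ENNReal.ofReal (c * W m) := by
    calc _ ≤ ∑ n ∈ B, ∑' m, ∑' j, ‖u j‖ₑ * (‖K (m - j)‖ₑ * D m j * ENNReal.ofReal (c * (w n * br (n - m) ^ (-(7 / 8) : ℝ)))) := by
          apply Finset.sum_le_sum
          intro n _
          rw [← ENNReal.tsum_mul_left]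
          apply ENNReal.tsum_le_tsum
          intro m
          rw [← ENNReal.tsum_mul_left, ← ENNReal.tsum_mul_left]
          apply ENNReal.tsum_le_tsum
          intro j
          have : ENNReal.ofReal (w n) * ‖kk (n - m)‖ₑ ≤ ENNReal.ofReal (c * (w n * br (n - m) ^ (-(7 / 8) : ℝ))) := by
            rw [← ofReal_norm, ← ENNReal.ofReal_mul (hw n)]
            apply ENNReal.ofReal_le_ofReal
            have := mul_le_mul_of_nonneg_left (hkk (n - m)) (hw n)
            linarith
          calc _ = ‖u j‖ₑ * (‖K (m - j)‖ₑ * D m j * (ENNReal.ofReal (w n) * ‖kk (n - m)‖ₑ)) := by ring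
            _ ≤ _ := by gcongr
      _ = ∑' m, ∑' j, ∑ n ∈ B, ‖u j‖ₑ * (‖K (m - j)‖ₑ * D m j * ENNReal.ofReal (c * (w n * br (n - m) ^ (-(7 / 8) : ℝ)))) := by
          rw [← Summable.tsum_finsetSum (fun _ _ => ENNReal.summable)]
          refine tsum_congr fun m => ?_
          rw [← Summable.tsum_finsetSum (fun _ _ => ENNReal.summable)]
      _ = ∑' m, ∑' j, ‖u j‖ₑ * (‖K (m - j)‖ₑ * D m j * ENNReal.ofReal (c * W m)) := by
          refine tsum_congr fun m => tsum_congr fun j => ?_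
          rw [← Finset.mul_sum, ← Finset.mul_sum, ← ENNReal.ofReal_sum_of_nonneg, ← Finset.mul_sum]
          intro n _
          have := hw n; have := br_pos (n - m); positivity
      _ = _ := by
          rw [ENNReal.tsum_comm]
          refine tsum_congr fun j => ?_
          rw [ENNReal.tsum_mul_left]
  refine step1.trans ?_
  have step2 : ∀ j, ∑' m, ‖K (m - j)‖ₑ * D m j * ENNReal.ofReal (c * W m) ≤ 
      ENNReal.ofReal (c * c * (C2 * (S j * N * (C1 * X)))) := by
    intro j
    have hinj : Function.Injective (fun k : ℤ => j + 2 * k) := fun x y hxy => by simpa using hxy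
    rw [← hinj.tsum_eq (f := fun m => ‖K (m - j)‖ₑ * D m j * ENNReal.ofReal (c * W m))]
    · calc _ ≤ ∑' k : ℤ, ENNReal.ofReal (c * c * (br k ^ (-(9 / 8) : ℝ) * ‖v (j + 2 * k) - v j‖ *
            (‖v (j + 2 * k)‖ + ‖v j‖) * W (j + 2 * k))) := by
            apply ENNReal.tsum_le_tsum
            intro k
            simp only [hD]
            rw [← ofReal_norm, ← ofReal_norm, ← ENNReal.ofReal_mul (norm_nonneg _),
              ← ENNReal.ofReal_mul (by positivity)]
            apply ENNReal.ofReal_le_ofReal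
            rw [add_sub_cancel_left]
            have hGd : ‖(v (j + 2 * k)).1 * (v (j + 2 * k)).2 - (v j).1 * (v j).2‖ ≤
                ‖v (j + 2 * k) - v j‖ * (‖v (j + 2 * k)‖ + ‖v j‖) := by
              set a := v (j + 2 * k)
              set b := v j
              calc ‖a.1 * a.2 - b.1 * b.2‖ = ‖a.1 * (a - b).2 + (a - b).1 * b.2‖ := by
                    congr 1; simp; ring
                _ ≤ ‖a.1‖ * ‖(a - b).2‖ + ‖(a - b).1‖ * ‖b.2‖ := by
                    refine (norm_add_le _ _).trans ?_
                    rw [norm_mul, norm_mul]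
                _ ≤ ‖a‖ * ‖a - b‖ + ‖a - b‖ * ‖b‖ := by
                    gcongr
                    · exact norm_fst_le a
                    · exact norm_snd_le (a - b)
                    · exact norm_fst_le (a - b)
                    · exact norm_snd_le b
                _ = _ := by ring
            have := hW0 (j + 2 * k)
            calc _ ≤ (c * br k ^ (-(9 / 8) : ℝ)) * (‖v (j + 2 * k) - v j‖ * (‖v (j + 2 * k)‖ + ‖v j‖)) * (c * W (j + 2 * k)) := by
                  have h1 := br_pos k
                  have h2 := hK k
                  gcongr
              _ = _ := by ring
        _ ≤ _ := by
            apply ennreal_tsum_le_of_real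
            · intro k
              have := hW0 (j + 2 * k); have := br_pos k; positivity
            · intro F
              rw [← Finset.mul_sum]
              gcongr
              apply H2 (fun k => ‖v (j + 2 * k) - v j‖) (fun k => ‖v (j + 2 * k)‖) (fun k => W (j + 2 * k)) ‖v j‖
                (S j) N (C1 * X) (fun _ => norm_nonneg _) (fun _ => norm_nonneg _) (fun _ => hW0 _) (norm_nonneg _)
                (hS j) hN (by positivity)
              · intro k
                have := norm_sub_norm_le (v j) (v (j + 2 * k))
                rw [norm_sub_rev] at this
                linarith
              · intro k; exact norm_sub_le _ _
              · intro k
                have := norm_sub_norm_le (v (j + 2 * k)) (v j)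
                linarith
              · have := hyN {j}
                simp at this
                exact le_of_pow_le_pow_left₀ (by norm_num) hN this
              · exact hdS j
              · intro F
                have := hyN (F.image fun k => j + 2 * k)
                rwa [Finset.sum_image (fun x _ y _ hxy => by simpa using hxy)] at this
              · intro F
                have := hW8 (F.image fun k => j + 2 * k)
                rw [Finset.sum_image (fun x _ y _ hxy => by simpa using hxy)] at this
                exact_mod_cast this
    · intro m hm
      rcases Int.even_or_odd' (m - j) with ⟨k, hk | hk⟩
      · exact ⟨k, by simp; omega⟩
      · exfalso
        apply hm
        simp only [hk, hKo]
        simp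
  calc _ ≤ ∑' j, ENNReal.ofReal (c * c * C2 * N * (C1 * X) * (‖u j‖ * S j)) := by
        apply ENNReal.tsum_le_tsum
        intro j
        refine (mul_le_mul_right (step2 j) _).trans (le_of_eq ?_)
        rw [← ofReal_norm, ← ENNReal.ofReal_mul (norm_nonneg _)]
        congr 1; ring
    _ ≤ _ := by
        apply ennreal_tsum_le_of_real
        · intro j; have := hS j; positivity
        · intro F
          rw [← Finset.mul_sum]
          have : ∑ j ∈ F, ‖u j‖ * S j ≤ U * A := by
            apply holder_bd' F _ _ 2 2 _ _ (by norm_num) (by norm_num) hU hA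
            · intro k _; positivity
            · intro k _; exact hS k
            · simpa using hu F
            · simpa using hSA F
          calc _ ≤ c * c * C2 * N * (C1 * X) * (U * A) := by gcongr
            _ = _ := by ring

lemma summable_conv2 (K b kk : ℤ → ℂ) (c : ℝ) (n : ℤ) (hK : Summable fun m => ‖K m‖) (hb : Summable fun m => ‖b m‖)
    (hkk : ∀ n, ‖kk n‖ ≤ c) : Summable fun p : ℤ × ℤ => kk (n - p.1) * (K (p.1 - p.2) * b p.2) := by
  have h1 : Summable fun x : ℤ × ℤ => ‖K x.1‖ * ‖b x.2‖ :=
    hK.mul_of_nonneg hb (fun _ => norm_nonneg _) (fun _ => norm_nonneg _)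
  have he : Function.Injective (fun p : ℤ × ℤ => (p.1 - p.2, p.2)) := by
    rintro ⟨a, b⟩ ⟨a', b'⟩ h
    simp only [Prod.mk.injEq] at h ⊢
    omega
  have h2 : Summable fun p : ℤ × ℤ => ‖K (p.1 - p.2)‖ * ‖b p.2‖ := by
    have := h1.comp_injective he
    simpa only [Function.comp_def] using this
  refine Summable.of_norm_bounded (h2.mul_left c) fun p => ?_
  rw [norm_mul, norm_mul]
  gcongr
  exact hkk _

lemma disc_norm (c : ℝ) (hc : 0 < c) : ∃ C > 0, ∀ (K kk : ℤ → ℂ) (v : ℤ → ℂ × ℂ) (A U : ℝ)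
    (u f L : ℤ → ℂ),
    (∀ k, ‖K (2 * k)‖ ≤ c * br k ^ (-(9 / 8) : ℝ)) → (∀ k, K (2 * k + 1) = 0) →
    (∀ n, ‖kk n‖ ≤ c * br n ^ (-(7 / 8) : ℝ)) → (Summable fun m => ‖K m‖) → 
    (∀ n j, ∑' m, kk (n - m) * K (m - j) = if n = j then 1 else 0) →
    0 ≤ A → 0 ≤ U → (∀ F : Finset ℤ, ∑ m ∈ F, ‖u m‖ ^ 2 ≤ U ^ 2) →
    (Summable fun n => ‖v n‖ ^ 2) →
    (∀ F1 F2 : Finset ℤ, ∑ m ∈ F1, ∑ k ∈ F2, ‖v (m + 2 * k) - v m‖ ^ 2 * br k ^ (-(7 / 4) : ℝ) ≤ A ^ 2) →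
    (∀ m, f m = ∑' j, K (m - j) * u j) →
    (∀ n, L n = ∑' m, kk (n - m) * (f m * (v m).1 * (v m).2)) →
    ∀ B : Finset ℤ, ∑ n ∈ B, ‖L n‖ ^ (4 / 3 : ℝ) ≤ (C * (U * A ^ 2)) ^ (4 / 3 : ℝ) := by
  obtain ⟨C, hC, H⟩ := comm_bound c hc
  refine ⟨(4 ^ 4) ^ 2 + C * 4 ^ 4, by positivity, ?_⟩
  intro K kk v A U u f L hK hKo hkk hKs hinv hA hU hu hv hD hf hL B
  obtain ⟨S, N, hS, hN, hNA, hSA, hdS, hyN⟩ := sob_full v A hA hv hD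
  have hub : ∀ j, ‖u j‖ ≤ U := fun j => by
    have := hu {j}
    simp at this
    exact le_of_sq_le_sq this hU
  have hkkc : ∀ n, ‖kk n‖ ≤ c := fun n => by
    refine (hkk n).trans ?_
    have : br n ^ (-(7 / 8) : ℝ) ≤ 1 := Real.rpow_le_one_of_one_le_of_nonpos (br_one_le n) (by norm_num)
    nlinarith
  set G : ℤ → ℂ := fun m => (v m).1 * (v m).2 with hG
  have hGn : ∀ m, ‖G m‖ ≤ ‖v m‖ ^ 2 := fun m => by
    rw [hG, norm_mul, sq]
    gcongr
    · exact norm_fst_le _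
    · exact norm_snd_le _
  have hGs : Summable fun m => ‖G m‖ := Summable.of_nonneg_of_le (fun _ => norm_nonneg _) hGn hv
  have hGu : Summable fun m => ‖G m * u m‖ := by
    refine Summable.of_nonneg_of_le (fun _ => norm_nonneg _) (fun m => ?_) (hGs.mul_right U)
    rw [norm_mul]
    gcongr
    exact hub m
  have hKm : ∀ m, Summable fun j => ‖K (m - j)‖ := fun m =>
    hKs.comp_injective (sub_right_injective (b := m))
  have hKu : ∀ m, Summable fun j => K (m - j) * u j := fun m => by
    refine Summable.of_norm_bounded ((hKm m).mul_right U) fun j => ?_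
    rw [norm_mul]
    gcongr
    exact hub j
  have hfb : ∀ m, ‖f m‖ ≤ (∑' j, ‖K j‖) * U := by
    intro m
    rw [hf m]
    refine (norm_tsum_le_tsum_norm (hKu m).norm).trans ?_
    rw [← tsum_mul_right, ← (Equiv.subLeft m).tsum_eq (fun j => ‖K j‖ * U)]
    refine Summable.tsum_le_tsum (fun j => ?_) (hKu m).norm ((hKm m).mul_right U)
    rw [norm_mul]
    simp only [Equiv.subLeft_apply]
    gcongr
    exact hub j
  have ident : ∀ n, L n = u n * G n + ∑' m, kk (n - m) * ∑' j, K (m - j) * ((G m - G j) * u j) := by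
    intro n
    have hs2 := summable_conv2 K (fun j => G j * u j) kk c n hKs hGu hkkc
    have e1 : ∑' m, ∑' j, kk (n - m) * (K (m - j) * (G j * u j)) = u n * G n := by
      rw [← Summable.tsum_comm (f := fun m j => kk (n - m) * (K (m - j) * (G j * u j))) hs2]
      rw [tsum_eq_single n]
      · simp_rw [← mul_assoc, tsum_mul_right, hinv]
        simp [mul_comm]
      · intro j hj
        simp_rw [← mul_assoc, tsum_mul_right, hinv]
        simp [Ne.symm hj]
    have hs3 : Summable fun m => ∑' j, kk (n - m) * (K (m - j) * (G j * u j)) := hs2.prod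
    have hs4 : Summable fun m => kk (n - m) * (f m * (v m).1 * (v m).2) := by
      refine Summable.of_norm_bounded ((hGs.mul_left (((∑' j, ‖K j‖) * U))).mul_left c) fun m => ?_
      rw [mul_assoc, norm_mul, norm_mul]
      have := hfb m
      have := hkkc (n - m)
      gcongr
    rw [← e1, hL, ← sub_eq_iff_eq_add', ← hs4.tsum_sub hs3]
    refine tsum_congr fun m => ?_
    have hKGu : Summable fun j => K (m - j) * (G j * u j) := by
      refine Summable.of_norm_bounded ((hKm m).mul_right (∑' j, ‖G j * u j‖)) fun j => ?_
      rw [norm_mul]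
      gcongr
      exact hGu.le_tsum j (fun _ _ => norm_nonneg _)
    rw [tsum_mul_left, ← mul_sub, hf]
    congr 1
    rw [mul_assoc, mul_comm, ← tsum_mul_left, ← ((hKu m).mul_left _).tsum_sub hKGu]
    refine tsum_congr fun j => ?_
    simp only [hG]
    ring
  have hLe : ∀ n, ‖L n‖ₑ ≤ ‖u n * G n‖ₑ + ∑' m, ‖kk (n - m)‖ₑ * ∑' j, ‖K (m - j)‖ₑ * (‖G m - G j‖ₑ * ‖u j‖ₑ) := by
    intro n
    rw [ident n]
    refine (enorm_add_le _ _).trans ?_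
    gcongr
    refine (enorm_tsum_le_tsum_enorm).trans ?_
    apply ENNReal.tsum_le_tsum
    intro m
    rw [enorm_mul]
    gcongr
    refine (enorm_tsum_le_tsum_enorm).trans ?_
    apply ENNReal.tsum_le_tsum
    intro j
    rw [enorm_mul, enorm_mul]
  set T := ∑ n ∈ B, ‖L n‖ ^ (4 / 3 : ℝ) with hT
  have hT0 : 0 ≤ T := Finset.sum_nonneg fun n _ => by positivity
  rcases hT0.eq_or_lt with h | hTp
  · rw [← h]; positivity
  set X := T ^ (1 / 4 : ℝ) with hX
  have hXp : 0 < X := by positivity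
  have hX4 : X ^ 4 = T := by rw [hX, ← Real.rpow_natCast, ← Real.rpow_mul hT0]; norm_num
  set w : ℤ → ℝ := fun n => ‖L n‖ ^ (1 / 3 : ℝ) with hw
  have hw0 : ∀ n, 0 ≤ w n := fun n => by positivity
  have hw4 : ∑ n ∈ B, w n ^ 4 = X ^ 4 := by
    rw [hX4, hT]
    refine Finset.sum_congr rfl fun n _ => ?_
    rw [hw]
    simp only
    rw [← Real.rpow_natCast, ← Real.rpow_mul (norm_nonneg _)]; norm_num
  have hTw : T = ∑ n ∈ B, w n * ‖L n‖ := by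
    rw [hT]
    refine Finset.sum_congr rfl fun n _ => ?_
    rw [hw]
    simp only
    rw [mul_comm, ← Real.rpow_one_add' (norm_nonneg _) (by norm_num)]; norm_num
  have main := H K kk v S N A U X u w B hK hKo hkk hS hN hA hU hXp hw0 hSA hdS hyN hu hw4.le
  have first : ∑ n ∈ B, w n * (‖u n‖ * ‖G n‖) ≤ U * (N ^ 2 * X) := by
    calc _ ≤ ∑ n ∈ B, ‖u n‖ * (‖v n‖ ^ 2 * w n) := by
          apply Finset.sum_le_sum
          intro n _
          have := hGn n
          have := hw0 n
          calc _ ≤ w n * (‖u n‖ * ‖v n‖ ^ 2) := by gcongr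
            _ = _ := by ring
      _ ≤ _ := by
          apply holder_bd' B _ _ 2 2 _ _ (by norm_num) (by norm_num) hU (by positivity)
          · intro k _; positivity
          · intro k _; have := hw0 k; positivity
          · simpa using hu B
          · calc _ = ∑ n ∈ B, ‖v n‖ ^ 4 * w n ^ 2 := by
                  refine Finset.sum_congr rfl fun n _ => ?_
                  rw [Real.rpow_two]; ring
              _ ≤ N ^ 4 * X ^ 2 := by
                  apply holder_bd' B _ _ 2 2 _ _ (by norm_num) (by norm_num) (by positivity) (by positivity)
                  · intro k _; positivity
                  · intro k _; positivity
                  · have := hyN B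
                    simp only [Real.rpow_two, ← pow_mul]
                    norm_num
                    exact_mod_cast this
                  · simp only [Real.rpow_two, ← pow_mul]
                    exact hw4.le
              _ = _ := by rw [Real.rpow_two]; ring
  have comb : ENNReal.ofReal T ≤ ENNReal.ofReal (U * (N ^ 2 * X) + C * (U * A * N * X)) := by
    rw [ENNReal.ofReal_add (by positivity) (by positivity)]
    calc ENNReal.ofReal T = ∑ n ∈ B, ENNReal.ofReal (w n) * ‖L n‖ₑ := by
          rw [hTw, ENNReal.ofReal_sum_of_nonneg (fun n _ => by have := hw0 n; positivity)]
          refine Finset.sum_congr rfl fun n _ => ?_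
          rw [ENNReal.ofReal_mul (hw0 n), ofReal_norm]
      _ ≤ ∑ n ∈ B, (ENNReal.ofReal (w n) * ‖u n * G n‖ₑ + ENNReal.ofReal (w n) *
            ∑' m, ‖kk (n - m)‖ₑ * ∑' j, ‖K (m - j)‖ₑ * (‖G m - G j‖ₑ * ‖u j‖ₑ)) := by
          apply Finset.sum_le_sum
          intro n _
          rw [← mul_add]
          gcongr
          exact hLe n
      _ ≤ _ := by
          rw [Finset.sum_add_distrib]
          refine add_le_add ?_ main
          refine le_trans (le_of_eq ?_) (ENNReal.ofReal_le_ofReal first)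
          rw [ENNReal.ofReal_sum_of_nonneg (fun n _ => by have := hw0 n; positivity)]
          refine Finset.sum_congr rfl fun n _ => ?_
          rw [ENNReal.ofReal_mul (hw0 n), ← norm_mul, ofReal_norm]
  rw [ENNReal.ofReal_le_ofReal_iff (by positivity)] at comb
  have hX3 : X ^ 3 ≤ ((4 ^ 4) ^ 2 + C * 4 ^ 4) * (U * A ^ 2) := by
    refine le_of_mul_le_mul_right ?_ hXp
    calc X ^ 3 * X = T := by rw [← hX4]; ring
      _ ≤ _ := comb
      _ ≤ U * ((4 ^ 4 * A) ^ 2 * X) + C * (U * A * (4 ^ 4 * A) * X) := by gcongr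
      _ = _ := by ring
  calc T = (X ^ 3) ^ (4 / 3 : ℝ) := by
        rw [← hX4, ← Real.rpow_natCast, ← Real.rpow_natCast, ← Real.rpow_mul hXp.le]; norm_num
    _ ≤ _ := by gcongr

lemma disc_pos (c : ℝ) (hc : 0 < c) : ∃ C > 0, ∀ (K kk : ℤ → ℂ) (g h : ℤ → ℂ) (a b U : ℝ)
    (u f L : ℤ → ℂ),
    (∀ k, ‖K (2 * k)‖ ≤ c * br k ^ (-(9 / 8) : ℝ)) → (∀ k, K (2 * k + 1) = 0) →
    (∀ n, ‖kk n‖ ≤ c * br n ^ (-(7 / 8) : ℝ)) → (Summable fun m => ‖K m‖) → 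
    (∀ n j, ∑' m, kk (n - m) * K (m - j) = if n = j then 1 else 0) →
    0 < a → 0 < b → 0 ≤ U → (∀ F : Finset ℤ, ∑ m ∈ F, ‖u m‖ ^ 2 ≤ U ^ 2) →
    (Summable fun n => ‖g n‖ ^ 2) → (Summable fun n => ‖h n‖ ^ 2) →
    (∀ F1 F2 : Finset ℤ, ∑ m ∈ F1, ∑ k ∈ F2, ‖g (m + 2 * k) - g m‖ ^ 2 * br k ^ (-(7 / 4) : ℝ) ≤ a ^ 2) →
    (∀ F1 F2 : Finset ℤ, ∑ m ∈ F1, ∑ k ∈ F2, ‖h (m + 2 * k) - h m‖ ^ 2 * br k ^ (-(7 / 4) : ℝ) ≤ b ^ 2) →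
    (∀ m, f m = ∑' j, K (m - j) * u j) →
    (∀ n, L n = ∑' m, kk (n - m) * (f m * g m * h m)) →
    ∀ B : Finset ℤ, ∑ n ∈ B, ‖L n‖ ^ (4 / 3 : ℝ) ≤ (C * (U * a * b)) ^ (4 / 3 : ℝ) := by
  obtain ⟨C, hC, H⟩ := disc_norm c hc
  refine ⟨C * 2, by positivity, ?_⟩
  intro K kk g h a b U u f L hK hKo hkk hKs hinv ha hb hU hu hg hh hDg hDh hf hL B
  have hac : (a : ℂ) ≠ 0 := by exact_mod_cast ha.ne'
  have hbc : (b : ℂ) ≠ 0 := by exact_mod_cast hb.ne'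
  have nsq : ∀ p : ℂ × ℂ, ‖p‖ ^ 2 ≤ ‖p.1‖ ^ 2 + ‖p.2‖ ^ 2 := by
    intro p
    rcases max_choice ‖p.1‖ ‖p.2‖ with h | h <;> rw [Prod.norm_def, h] <;> nlinarith [sq_nonneg ‖p.1‖, sq_nonneg ‖p.2‖]
  have := H K kk (fun n => (g n / a, h n / b)) (√2) U u f (fun n => L n / (a * b)) hK hKo hkk hKs hinv
    (by positivity) hU hu ?_ ?_ hf ?_ B
  · rw [Real.sq_sqrt (by norm_num)] at this
    have e : ∑ n ∈ B, ‖L n‖ ^ (4 / 3 : ℝ) = (a * b) ^ (4 / 3 : ℝ) * ∑ n ∈ B, ‖L n / (a * b)‖ ^ (4 / 3 : ℝ) := by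
      rw [Finset.mul_sum]
      refine Finset.sum_congr rfl fun n _ => ?_
      rw [← Real.mul_rpow (by positivity) (by positivity)]
      congr 1
      rw [norm_div, norm_mul, Complex.norm_real, Complex.norm_real, Real.norm_of_nonneg ha.le, Real.norm_of_nonneg hb.le]
      field_simp
    rw [e]
    calc _ ≤ (a * b) ^ (4 / 3 : ℝ) * (C * (U * 2)) ^ (4 / 3 : ℝ) := by gcongr
      _ = _ := by
        rw [← Real.mul_rpow (by positivity) (by positivity)]
        congr 1; ring
  · refine Summable.of_nonneg_of_le (fun n => by positivity) (fun n => nsq _) ?_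
    simp only [norm_div, div_pow]
    exact (hg.div_const _).add (hh.div_const _)
  · intro F1 F2
    rw [Real.sq_sqrt (by norm_num)]
    calc _ ≤ ∑ m ∈ F1, ∑ k ∈ F2, ((‖g (m + 2 * k) - g m‖ ^ 2 * br k ^ (-(7 / 4) : ℝ)) / a ^ 2 +
          (‖h (m + 2 * k) - h m‖ ^ 2 * br k ^ (-(7 / 4) : ℝ)) / b ^ 2) := by
          refine Finset.sum_le_sum fun m _ => Finset.sum_le_sum fun k _ => ?_
          have := br_pos k
          refine (mul_le_mul_of_nonneg_right (nsq _) (by positivity)).trans (le_of_eq ?_)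
          simp only [Prod.fst_sub, Prod.snd_sub, ← sub_div, norm_div, div_pow, Complex.norm_real, Real.norm_eq_abs, sq_abs]
          ring
      _ ≤ 1 + 1 := by
          simp_rw [Finset.sum_add_distrib, ← Finset.sum_div]
          have := hDg F1 F2
          have := hDh F1 F2
          gcongr
          · rw [div_le_one (by positivity)]; assumption
          · rw [div_le_one (by positivity)]; assumption
      _ = 2 := by norm_num
  · intro n
    simp only
    rw [hL, ← tsum_div_const]
    refine tsum_congr fun m => ?_
    field_simp

lemma disc_full (c : ℝ) (hc : 0 < c) : ∃ C > 0, ∀ (K kk : ℤ → ℂ) (g h : ℤ → ℂ) (a b U : ℝ)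
    (u f L : ℤ → ℂ),
    (∀ k, ‖K (2 * k)‖ ≤ c * br k ^ (-(9 / 8) : ℝ)) → (∀ k, K (2 * k + 1) = 0) →
    (∀ n, ‖kk n‖ ≤ c * br n ^ (-(7 / 8) : ℝ)) → (Summable fun m => ‖K m‖) → 
    (∀ n j, ∑' m, kk (n - m) * K (m - j) = if n = j then 1 else 0) →
    0 ≤ a → 0 ≤ b → 0 ≤ U → (∀ F : Finset ℤ, ∑ m ∈ F, ‖u m‖ ^ 2 ≤ U ^ 2) →
    (Summable fun n => ‖g n‖ ^ 2) → (Summable fun n => ‖h n‖ ^ 2) →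
    (∀ F1 F2 : Finset ℤ, ∑ m ∈ F1, ∑ k ∈ F2, ‖g (m + 2 * k) - g m‖ ^ 2 * br k ^ (-(7 / 4) : ℝ) ≤ a ^ 2) →
    (∀ F1 F2 : Finset ℤ, ∑ m ∈ F1, ∑ k ∈ F2, ‖h (m + 2 * k) - h m‖ ^ 2 * br k ^ (-(7 / 4) : ℝ) ≤ b ^ 2) →
    (∀ m, f m = ∑' j, K (m - j) * u j) →
    (∀ n, L n = ∑' m, kk (n - m) * (f m * g m * h m)) →
    (∑' n, ‖L n‖ ^ (4 / 3 : ℝ)) ^ (3 / 4 : ℝ) ≤ C * (U * a * b) := by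
  obtain ⟨C, hC, H⟩ := disc_pos c hc
  refine ⟨C, hC, ?_⟩
  intro K kk g h a b U u f L hK hKo hkk hKs hinv ha hb hU hu hg hh hDg hDh hf hL
  have key : ∀ ε > (0 : ℝ), (∑' n, ‖L n‖ ^ (4 / 3 : ℝ)) ^ (3 / 4 : ℝ) ≤ C * (U * (a + ε) * (b + ε)) := by
    intro ε hε
    have h1 : ∑' n, ‖L n‖ ^ (4 / 3 : ℝ) ≤ (C * (U * (a + ε) * (b + ε))) ^ (4 / 3 : ℝ) := by
      apply Real.tsum_le_of_sum_le (fun n => by positivity)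
      apply H K kk g h (a + ε) (b + ε) U u f L hK hKo hkk hKs hinv (by positivity) (by positivity) hU hu hg hh
        ?_ ?_ hf hL
      · intro F1 F2
        refine (hDg F1 F2).trans ?_
        gcongr; linarith
      · intro F1 F2
        refine (hDh F1 F2).trans ?_
        gcongr; linarith
    calc _ ≤ ((C * (U * (a + ε) * (b + ε))) ^ (4 / 3 : ℝ)) ^ (3 / 4 : ℝ) :=
          Real.rpow_le_rpow (tsum_nonneg fun n => by positivity) h1 (by norm_num)
      _ = _ := by
          rw [← Real.rpow_mul (by positivity)]; norm_num
  have hcont : Filter.Tendsto (fun ε : ℝ => C * (U * (a + ε) * (b + ε))) (nhdsWithin 0 (Set.Ioi 0))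
      (nhds (C * (U * (a + 0) * (b + 0)))) := by
    apply Filter.Tendsto.mono_left _ nhdsWithin_le_nhds
    exact Continuous.tendsto (by fun_prop) 0
  rw [add_zero, add_zero] at hcont
  refine ge_of_tendsto hcont ?_
  filter_upwards [self_mem_nhdsWithin] with ε hε
  exact key ε hε

noncomputable def cf (φ : ℝ → ℂ) (n : ℤ) : ℂ :=
  (2 * π)⁻¹ • ∫ θ in (-π)..π, φ θ * Complex.exp (Complex.I * n * θ)

noncomputable def sp (s : ℝ) (θ : ℝ) : ℂ := ((|Real.sin θ| ^ s : ℝ) : ℂ)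

lemma sin_rpow_meas (s : ℝ) : Measurable fun θ : ℝ => |Real.sin θ| ^ s := by
  fun_prop

lemma sin_rpow_periodic (s : ℝ) : Function.Periodic (fun θ : ℝ => |Real.sin θ| ^ s) π := by
  intro θ
  simp [Real.sin_add_pi]

lemma sin_rpow_int (s : ℝ) (hs : -1 < s) (a b : ℝ) :
    IntervalIntegrable (fun θ : ℝ => |Real.sin θ| ^ s) volume a b := by
  rcases le_or_gt 0 s with h0 | h0
  · apply Continuous.intervalIntegrable
    exact (Real.continuous_sin.abs).rpow_const (fun _ => Or.inr h0)
  have hp := Real.pi_pos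
  have h1 : IntervalIntegrable (fun θ : ℝ => |Real.sin θ| ^ s) volume 0 (π / 2) := by
    have hi : IntervalIntegrable (fun θ : ℝ => (2 / π) ^ s * θ ^ s) volume 0 (π / 2) :=
      (intervalIntegral.intervalIntegrable_rpow' hs).const_mul _
    refine hi.mono_fun (sin_rpow_meas s).aestronglyMeasurable ?_
    rw [Filter.EventuallyLE, ae_restrict_iff' measurableSet_uIoc]
    refine Filter.Eventually.of_forall fun θ hθ => ?_
    rw [Set.uIoc_of_le (by positivity)] at hθ
    have hθ0 := hθ.1
    have := Real.mul_le_sin hθ.1.le hθ.2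
    rw [← Real.mul_rpow (by positivity) hθ0.le]
    have h3 : 0 < 2 / π * θ := by positivity
    rw [Real.norm_of_nonneg (by positivity), Real.norm_of_nonneg (by positivity), abs_of_pos (h3.trans_le this)]
    exact Real.rpow_le_rpow_of_nonpos h3 this h0.le
  have h2 : IntervalIntegrable (fun θ : ℝ => |Real.sin θ| ^ s) volume (π / 2) π := by
    have := (h1.comp_sub_left π).symm
    simp only [Real.sin_pi_sub] at this
    convert this using 1 <;> ring
  exact (sin_rpow_periodic s).intervalIntegrable (t := 0) hp.ne' (by rw [zero_add]; exact h1.trans h2) a b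

lemma sp_int (s : ℝ) (hs : -1 < s) (a b : ℝ) : IntervalIntegrable (sp s) volume a b :=
  ⟨(sin_rpow_int s hs a b).1.ofReal, (sin_rpow_int s hs a b).2.ofReal⟩

lemma exp_int (φ : ℝ → ℂ) (a b : ℝ) (hφ : IntervalIntegrable φ volume a b) (n : ℤ) :
    IntervalIntegrable (fun θ : ℝ => φ θ * Complex.exp (Complex.I * n * θ)) volume a b :=
  hφ.mul_continuousOn (by fun_prop)

lemma exp_pi (n : ℤ) : Complex.exp (Complex.I * n * π) = (-1) ^ n := by
  rw [show Complex.I * n * π = n * (π * Complex.I) by ring, Complex.exp_int_mul, Complex.exp_pi_mul_I]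

noncomputable def Js (s : ℝ) (n : ℤ) : ℂ := ∫ θ in (0 : ℝ)..π, sp s θ * Complex.exp (Complex.I * n * θ)

lemma cf_sp (s : ℝ) (hs : -1 < s) (n : ℤ) : cf (sp s) n = (2 * π)⁻¹ • ((1 + (-1) ^ n) * Js s n) := by
  unfold cf Js
  congr 1
  rw [← intervalIntegral.integral_add_adjacent_intervals (b := 0) (exp_int _ _ _ (sp_int s hs _ _) n)
    (exp_int _ _ _ (sp_int s hs _ _) n)]
  have : ∫ θ in (-π)..0, sp s θ * Complex.exp (Complex.I * n * θ) =
      ∫ θ in (0 : ℝ)..π, (-1) ^ n * (sp s θ * Complex.exp (Complex.I * n * θ)) := by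
    have h := intervalIntegral.integral_comp_add_right (a := -π) (b := 0) (fun θ : ℝ => (-1) ^ n * (sp s θ * Complex.exp (Complex.I * n * θ))) π
    rw [neg_add_cancel, zero_add] at h
    rw [← h]
    refine intervalIntegral.integral_congr fun θ _ => ?_
    simp only [sp, Real.sin_add_pi, abs_neg]
    push_cast
    rw [mul_add, Complex.exp_add, exp_pi]
    have : ((-1 : ℂ) ^ n) * (-1) ^ n = 1 := by
      rw [← mul_zpow]; norm_num
    linear_combination (-(((|Real.sin θ| ^ s : ℝ) : ℂ) * Complex.exp (Complex.I * n * θ))) * this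
  rw [this, intervalIntegral.integral_const_mul]
  ring

lemma cf_sp_odd (s : ℝ) (hs : -1 < s) (k : ℤ) : cf (sp s) (2 * k + 1) = 0 := by
  rw [cf_sp s hs, Odd.neg_one_zpow ⟨k, rfl⟩]; simp

lemma cf_sp_even (s : ℝ) (hs : -1 < s) (k : ℤ) : cf (sp s) (2 * k) = π⁻¹ • Js s (2 * k) := by
  have := Real.pi_pos
  rw [cf_sp s hs, Even.neg_one_zpow ⟨k, by ring⟩, Complex.real_smul, Complex.real_smul]
  push_cast
  have : (π : ℂ) ≠ 0 := by exact_mod_cast this.ne'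
  field_simp
  ring

lemma cf_sp_neg (s : ℝ) (n : ℤ) : cf (sp s) (-n) = cf (sp s) n := by
  unfold cf
  congr 1
  have h := intervalIntegral.integral_comp_neg (a := -π) (b := π) (fun θ : ℝ => sp s θ * Complex.exp (Complex.I * n * θ))
  rw [neg_neg] at h
  rw [← h]
  refine intervalIntegral.integral_congr fun θ _ => ?_
  simp [sp]

lemma Js_rec (s : ℝ) (hs : -1 < s) (n : ℤ) : (n + s + 2 : ℂ) * Js s (n + 2) = (n - s) * Js s n := by
  have hp := Real.pi_pos
  set Φ : ℝ → ℂ := fun θ => ((Real.sin θ ^ (s + 1) : ℝ) : ℂ) * Complex.exp (Complex.I * (n + 1) * θ)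
  set Φ' : ℝ → ℂ := fun θ => (n + s + 2) / 2 * (sp s θ * Complex.exp (Complex.I * (n + 2 : ℤ) * θ)) -
    (n - s) / 2 * (sp s θ * Complex.exp (Complex.I * n * θ))
  have hd : ∀ x ∈ Set.Ioo 0 π, HasDerivAt Φ (Φ' x) x := by
    intro x hx
    have hsx := Real.sin_pos_of_pos_of_lt_pi hx.1 hx.2
    have d1 : HasDerivAt (fun θ : ℝ => ((Real.sin θ ^ (s + 1) : ℝ) : ℂ))
        ((Real.cos x * (s + 1) * Real.sin x ^ (s + 1 - 1) : ℝ) : ℂ) x :=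
      ((Real.hasDerivAt_sin x).rpow_const (Or.inl hsx.ne')).ofReal_comp
    have d2 : HasDerivAt (fun θ : ℝ => Complex.exp (Complex.I * (n + 1) * θ))
        (Complex.exp (Complex.I * (n + 1) * x) * (Complex.I * (n + 1))) x := by
      have : HasDerivAt (fun θ : ℝ => Complex.I * (n + 1) * (θ : ℂ)) (Complex.I * (n + 1)) x := by
        simpa using (HasDerivAt.ofReal_comp (hasDerivAt_id x)).const_mul (Complex.I * (n + 1))
      exact this.cexp
    refine (d1.mul d2).congr_deriv ?_
    simp only [Φ', sp, abs_of_pos hsx, add_sub_cancel_right]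
    rw [Real.rpow_add_one hsx.ne']
    push_cast
    have e1 : Complex.exp (Complex.I * (n + 2) * x) = Complex.exp (Complex.I * (n + 1) * x) * (Complex.cos x + Complex.sin x * Complex.I) := by
      rw [← Complex.exp_mul_I, ← Complex.exp_add]; congr 1; ring
    have e2 : Complex.exp (Complex.I * n * x) = Complex.exp (Complex.I * (n + 1) * x) * (Complex.cos x - Complex.sin x * Complex.I) := by
      have : Complex.cos x - Complex.sin x * Complex.I = Complex.exp (-x * Complex.I) := by
        rw [Complex.exp_mul_I, Complex.cos_neg, Complex.sin_neg]; ring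
      rw [this, ← Complex.exp_add]; congr 1; ring
    rw [e1, e2]
    ring_nf
  have hcont : ContinuousOn Φ (Set.Icc 0 π) := by
    apply Continuous.continuousOn
    apply Continuous.mul
    · exact Complex.continuous_ofReal.comp (Real.continuous_sin.rpow_const (fun _ => Or.inr (by linarith)))
    · fun_prop
  have hi : IntervalIntegrable Φ' volume 0 π :=
    ((exp_int _ _ _ (sp_int s hs _ _) (n + 2)).const_mul _).sub ((exp_int _ _ _ (sp_int s hs _ _) n).const_mul _)
  have h := intervalIntegral.integral_eq_sub_of_hasDerivAt_of_le hp.le hcont hd hi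
  have hz : Φ π - Φ 0 = 0 := by
    simp [Φ, Real.zero_rpow (show s + 1 ≠ 0 by linarith)]
  rw [hz] at h
  simp only [Φ'] at h
  rw [intervalIntegral.integral_sub ((exp_int _ _ _ (sp_int s hs _ _) (n + 2)).const_mul _)
    ((exp_int _ _ _ (sp_int s hs _ _) n).const_mul _), intervalIntegral.integral_const_mul,
    intervalIntegral.integral_const_mul] at h
  unfold Js
  linear_combination 2 * h

lemma cf_rec (s : ℝ) (hs : -1 < s) (k : ℕ) :
    (2 * k + s + 2) * ‖cf (sp s) (2 * (k + 1 : ℕ))‖ = |2 * k - s| * ‖cf (sp s) (2 * (k : ℕ))‖ := by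
  have h := Js_rec s hs (2 * k)
  rw [cf_sp_even s hs, cf_sp_even s hs, norm_smul, norm_smul]
  have h2 := congrArg norm h
  rw [norm_mul, norm_mul] at h2
  have e1 : ‖(((2 * k : ℤ) : ℂ) + s + 2)‖ = 2 * k + s + 2 := by
    rw [show (((2 * k : ℤ) : ℂ) + s + 2) = ((2 * k + s + 2 : ℝ) : ℂ) by push_cast; ring, Complex.norm_real,
      Real.norm_of_nonneg]
    have : (0 : ℝ) ≤ k := by positivity
    linarith
  have e2 : ‖(((2 * k : ℤ) : ℂ) - s)‖ = |2 * k - s| := by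
    rw [show (((2 * k : ℤ) : ℂ) - s) = ((2 * k - s : ℝ) : ℂ) by push_cast; ring, Complex.norm_real, Real.norm_eq_abs]
  rw [e1, e2] at h2
  push_cast
  rw [show (2 * ((k : ℤ) + 1)) = 2 * k + 2 by ring]
  linear_combination ‖π⁻¹‖ * h2

lemma decay_seq (c : ℕ → ℝ) (p : ℝ) (h : ∀ k : ℕ, c (k + 1) * ((k : ℝ) + 2) ^ p ≤ c k * ((k : ℝ) + 1) ^ p) (k : ℕ) :
    c k ≤ c 0 * ((k : ℝ) + 1) ^ (-p) := by
  have : c k * ((k : ℝ) + 1) ^ p ≤ c 0 := by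
    induction k with
    | zero => simp
    | succ k ih =>
      refine le_trans ?_ ih
      have := h k
      push_cast
      rwa [show (k : ℝ) + 1 + 1 = k + 2 by ring]
  rw [Real.rpow_neg (by positivity), ← div_eq_mul_inv, le_div_iff₀ (by positivity)]
  exact this

lemma K_decay : ∃ c > 0, ∀ k : ℤ, ‖cf (sp (1 / 8)) (2 * k)‖ ≤ c * br k ^ (-(9 / 8) : ℝ) := by
  refine ⟨‖cf (sp (1 / 8)) 0‖ + 1, by positivity, ?_⟩
  have hN : ∀ k : ℕ, ‖cf (sp (1 / 8)) (2 * (k : ℕ))‖ ≤ ‖cf (sp (1 / 8)) 0‖ * ((k : ℝ) + 1) ^ (-(9 / 8) : ℝ) := by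
    intro k
    have := decay_seq (fun k : ℕ => ‖cf (sp (1 / 8)) (2 * (k : ℕ))‖) (9 / 8) ?_ k
    · simpa using this
    · intro k
      have h := cf_rec (1 / 8) (by norm_num) k
      set x := ‖cf (sp (1 / 8)) (2 * (k + 1 : ℕ))‖
      set y := ‖cf (sp (1 / 8)) (2 * (k : ℕ))‖
      have hy : 0 ≤ y := norm_nonneg _
      have hk : (0 : ℝ) ≤ k := by positivity
      have hb : 1 - (9 / 8) / ((k : ℝ) + 2) ≤ (((k : ℝ) + 1) / (k + 2)) ^ (9 / 8 : ℝ) := by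
        have := one_add_mul_self_le_rpow_one_add (s := -1 / ((k : ℝ) + 2)) (p := 9 / 8) (by
          rw [le_div_iff₀ (by positivity)]; linarith) (by norm_num)
        refine le_trans (le_of_eq ?_) (this.trans (le_of_eq ?_))
        · ring
        · congr 1; field_simp; ring
      rw [Real.div_rpow (by positivity) (by positivity), le_div_iff₀ (by positivity)] at hb
      have hr : |2 * (k : ℝ) - 1 / 8| ≤ (1 - (9 / 8) / ((k : ℝ) + 2)) * (2 * k + 1 / 8 + 2) := by
        rw [abs_le]
        rcases Nat.eq_zero_or_pos k with h0 | h0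
        · subst h0; norm_num
        · have : (1 : ℝ) ≤ k := by exact_mod_cast h0
          have e : (1 - (9 / 8) / ((k : ℝ) + 2)) * (2 * k + 1 / 8 + 2) = 2 * k - 1 / 8 + (9 / 4) - (9 / 8) * ((2 * k + 17 / 8) / (k + 2)) := by
            field_simp; ring
          have e2 : (2 * (k : ℝ) + 17 / 8) / (k + 2) ≤ 2 := by
            rw [div_le_iff₀ (by positivity)]; linarith
          rw [e]
          constructor <;> linarith
      have hx : x = |2 * (k : ℝ) - 1 / 8| * y / (2 * k + 1 / 8 + 2) := by
        rw [← h]; field_simp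
      rw [hx]
      have hp : 0 < ((k : ℝ) + 2) ^ (9 / 8 : ℝ) := by positivity
      calc _ ≤ ((1 - (9 / 8) / ((k : ℝ) + 2)) * (2 * k + 1 / 8 + 2)) * y / (2 * k + 1 / 8 + 2) * ((k : ℝ) + 2) ^ (9 / 8 : ℝ) := by
            gcongr
        _ = y * ((1 - (9 / 8) / ((k : ℝ) + 2)) * ((k : ℝ) + 2) ^ (9 / 8 : ℝ)) := by
            field_simp
        _ ≤ _ := by gcongr
  intro k
  have e : ‖cf (sp (1 / 8)) (2 * k)‖ = ‖cf (sp (1 / 8)) (2 * (k.natAbs : ℕ))‖ := by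
    rcases Int.natAbs_eq k with h | h
    · rw [← h]
    · conv_lhs => rw [h]
      rw [mul_neg, cf_sp_neg]
  rw [e, br_natAbs]
  refine (hN _).trans ?_
  gcongr
  linarith

lemma kk_decay : ∃ c > 0, ∀ n : ℤ, ‖cf (sp (-(1 / 8))) n‖ ≤ c * br n ^ (-(7 / 8) : ℝ) := by
  refine ⟨2 * (‖cf (sp (-(1 / 8))) 0‖ + 1), by positivity, ?_⟩
  have hN : ∀ k : ℕ, ‖cf (sp (-(1 / 8))) (2 * (k : ℕ))‖ ≤ ‖cf (sp (-(1 / 8))) 0‖ * ((k : ℝ) + 1) ^ (-(7 / 8) : ℝ) := by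
    intro k
    have := decay_seq (fun k : ℕ => ‖cf (sp (-(1 / 8))) (2 * (k : ℕ))‖) (7 / 8) ?_ k
    · simpa using this
    · intro k
      have h := cf_rec (-(1 / 8)) (by norm_num) k
      set x := ‖cf (sp (-(1 / 8))) (2 * (k + 1 : ℕ))‖
      set y := ‖cf (sp (-(1 / 8))) (2 * (k : ℕ))‖
      have hy : 0 ≤ y := norm_nonneg _
      have hk : (0 : ℝ) ≤ k := by positivity
      have hb : (((k : ℝ) + 2) / (k + 1)) ^ (7 / 8 : ℝ) ≤ 1 + (7 / 8) * (1 / ((k : ℝ) + 1)) := by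
        have := rpow_one_add_le_one_add_mul_self (s := 1 / ((k : ℝ) + 1)) (p := 7 / 8) (by
          have : 0 ≤ 1 / ((k : ℝ) + 1) := by positivity
          linarith) (by norm_num) (by norm_num)
        refine le_trans (le_of_eq ?_) this
        congr 1; field_simp; ring
      rw [Real.div_rpow (by positivity) (by positivity), div_le_iff₀ (by positivity)] at hb
      rw [abs_of_nonneg (by linarith)] at h
      have hx : x = (2 * (k : ℝ) - -(1 / 8)) * y / (2 * k + -(1 / 8) + 2) := by
        have : 2 * (k : ℝ) + -(1 / 8) + 2 ≠ 0 := by linarith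
        rw [eq_div_iff this]
        linarith
      rw [hx]
      have hp : 0 < ((k : ℝ) + 1) ^ (7 / 8 : ℝ) := by positivity
      have hden : 0 < 2 * (k : ℝ) + -(1 / 8) + 2 := by linarith
      have hr : (2 * (k : ℝ) - -(1 / 8)) * (1 + (7 / 8) * (1 / ((k : ℝ) + 1))) ≤ (2 * k + -(1 / 8) + 2) := by
        have : (2 * (k : ℝ) - -(1 / 8)) * (1 + (7 / 8) * (1 / ((k : ℝ) + 1))) = ((2 * (k : ℝ) + 1 / 8) * (k + 15 / 8)) / (k + 1) := by
          field_simp; ring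
        rw [this, div_le_iff₀ (by positivity)]
        nlinarith
      have hq : 0 ≤ (2 * (k : ℝ) - -(1 / 8)) := by linarith
      calc _ ≤ (2 * (k : ℝ) - -(1 / 8)) * y / (2 * k + -(1 / 8) + 2) * ((1 + (7 / 8) * (1 / ((k : ℝ) + 1))) * ((k : ℝ) + 1) ^ (7 / 8 : ℝ)) := by
            gcongr
        _ = ((2 * (k : ℝ) - -(1 / 8)) * (1 + (7 / 8) * (1 / ((k : ℝ) + 1)))) / (2 * k + -(1 / 8) + 2) * (y * ((k : ℝ) + 1) ^ (7 / 8 : ℝ)) := by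
            ring
        _ ≤ 1 * (y * ((k : ℝ) + 1) ^ (7 / 8 : ℝ)) := by
            gcongr
            rw [div_le_one hden]
            exact hr
        _ = _ := one_mul _
  intro n
  have hbn := br_pos n
  rcases Int.even_or_odd' n with ⟨k, rfl | rfl⟩
  · have e : ‖cf (sp (-(1 / 8))) (2 * k)‖ = ‖cf (sp (-(1 / 8))) (2 * (k.natAbs : ℕ))‖ := by
      rcases Int.natAbs_eq k with h | h
      · rw [← h]
      · conv_lhs => rw [h]
        rw [mul_neg, cf_sp_neg]
    rw [e]
    refine (hN _).trans ?_
    rw [← br_natAbs]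
    have hb2 : br k ^ (-(7 / 8) : ℝ) ≤ 2 * br (2 * k) ^ (-(7 / 8) : ℝ) := by
      calc br k ^ (-(7 / 8) : ℝ) ≤ (br (2 * k) / 2) ^ (-(7 / 8) : ℝ) := by
            apply Real.rpow_le_rpow_of_nonpos (by positivity) _ (by norm_num)
            unfold br
            push_cast
            rw [abs_mul]
            norm_num
            linarith
        _ = (1 / 2 : ℝ) ^ (-(7 / 8) : ℝ) * br (2 * k) ^ (-(7 / 8) : ℝ) := by
            rw [← Real.mul_rpow (by norm_num) hbn.le]; congr 1; ring
        _ ≤ _ := by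
            gcongr
            calc (1 / 2 : ℝ) ^ (-(7 / 8) : ℝ) ≤ (1 / 2 : ℝ) ^ (-1 : ℝ) :=
                  Real.rpow_le_rpow_of_exponent_ge (by norm_num) (by norm_num) (by norm_num)
              _ = 2 := by rw [Real.rpow_neg_one]; norm_num
    have := br_pos k
    calc _ ≤ (‖cf (sp (-(1 / 8))) 0‖ + 1) * (2 * br (2 * k) ^ (-(7 / 8) : ℝ)) := by
          gcongr
          linarith
      _ = _ := by ring
  · rw [cf_sp_odd _ (by norm_num)]
    simp
    positivity

lemma K_summable : Summable fun n => ‖cf (sp (1 / 8)) n‖ := by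
  obtain ⟨c, hc, h⟩ := K_decay
  obtain ⟨C, hC, H⟩ := far_sum (9 / 8) (by norm_num)
  have hinj : Function.Injective (fun k : ℤ => 2 * k) := fun x y hxy => by simpa using hxy
  rw [← hinj.summable_iff]
  · have hb : Summable fun k => br k ^ (-(9 / 8) : ℝ) := by
      apply summable_of_sum_le (c := C * (1 / 2 : ℝ) ^ (1 - 9 / 8 : ℝ))
      · intro k; have := br_pos k; positivity
      · intro F
        have := H (1 / 2) (by norm_num) F
        rwa [Finset.filter_true_of_mem] at this
        intro k _
        have := br_one_le k
        linarith
    exact Summable.of_nonneg_of_le (fun _ => norm_nonneg _) h (hb.mul_left c)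
  · intro n hn
    rcases Int.even_or_odd' n with ⟨k, rfl | rfl⟩
    · exact absurd ⟨k, rfl⟩ hn
    · rw [cf_sp_odd _ (by norm_num), norm_zero]

lemma norm_exp_I (n : ℤ) (θ : ℝ) : ‖Complex.exp (Complex.I * n * θ)‖ = 1 := by
  rw [show Complex.I * n * θ = ((n * θ : ℝ) : ℂ) * Complex.I by push_cast; ring, Complex.norm_exp_ofReal_mul_I]

lemma fourier_exp (n : ℤ) (x : ℝ) : (fourier n (x : AddCircle (2 * π)) : ℂ) = Complex.exp (Complex.I * n * x) := by
  rw [fourier_coe_apply]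
  congr 1
  have : (π : ℂ) ≠ 0 := by exact_mod_cast Real.pi_ne_zero
  push_cast
  field_simp

lemma cf_conv (φ : ℝ → ℂ) (hφ : IntervalIntegrable φ volume (-π) π) (a : ℤ → ℂ) (ha : Summable fun m => ‖a m‖) (n : ℤ) :
    cf (fun θ => φ θ * dtft a θ) n = ∑' m, a m * cf φ (n - m) := by
  have hp : -π ≤ π := by linarith [Real.pi_pos]
  have hφ' : IntegrableOn φ (Set.Ioc (-π) π) := (intervalIntegrable_iff_integrableOn_Ioc_of_le hp).1 hφ
  set F : ℤ → ℝ → ℂ := fun m θ => a m * (φ θ * Complex.exp (Complex.I * (n - m : ℤ) * θ)) with hF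
  have hintg : ∀ m : ℤ, IntegrableOn (fun θ : ℝ => φ θ * Complex.exp (Complex.I * (m : ℤ) * θ)) (Set.Ioc (-π) π) := fun m =>
    (intervalIntegrable_iff_integrableOn_Ioc_of_le hp).1 (exp_int φ _ _ hφ m)
  have hs := hasSum_integral_of_summable_integral_norm (μ := volume.restrict (Set.Ioc (-π) π)) (F := F)
    (fun m => (hintg (n - m)).const_mul (a m)) (by
      have : (fun m => ∫ θ in Set.Ioc (-π) π, ‖F m θ‖) = fun m => ‖a m‖ * ∫ θ in Set.Ioc (-π) π, ‖φ θ‖ := by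
        ext m
        rw [← integral_const_mul]
        congr 1
        ext θ
        simp only [hF]
        rw [norm_mul, norm_mul, norm_exp_I, mul_one]
      rw [this]
      exact ha.mul_right _)
  unfold cf
  have e : ∀ m, a m * (2 * π)⁻¹ • ∫ θ in (-π)..π, φ θ * Complex.exp (Complex.I * (n - m : ℤ) * θ) =
      (2 * π)⁻¹ • ∫ θ in Set.Ioc (-π) π, F m θ := by
    intro m
    rw [intervalIntegral.integral_of_le hp, mul_smul_comm, ← integral_const_mul]
  simp_rw [e]
  rw [tsum_const_smul'', hs.tsum_eq, intervalIntegral.integral_of_le hp]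
  congr 2
  ext θ
  simp only [hF, dtft]
  rw [← tsum_mul_left, ← tsum_mul_right]
  refine tsum_congr fun m => ?_
  rw [show Complex.I * (n - m : ℤ) * θ = -(Complex.I * m * θ) + Complex.I * n * θ by push_cast; ring, Complex.exp_add]
  ring

lemma dtft_K (θ : ℝ) : dtft (cf (sp (1 / 8))) θ = sp (1 / 8) θ := by
  have : Fact (0 < 2 * π) := ⟨by positivity⟩
  have hper : Function.Periodic (sp (1 / 8)) (2 * π) := by
    intro x; simp [sp]
  have hcont : Continuous (sp (1 / 8)) :=
    Complex.continuous_ofReal.comp ((Real.continuous_sin.abs).rpow_const (fun _ => Or.inr (by norm_num)))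
  let f : C(AddCircle (2 * π), ℂ) := ⟨hper.lift, by
    exact hcont.quotient_lift _⟩
  have hfx : ∀ x : ℝ, f (x : AddCircle (2 * π)) = sp (1 / 8) x := fun x => hper.lift_coe x
  have hco : ∀ n : ℤ, fourierCoeff f n = cf (sp (1 / 8)) n := by
    intro n
    rw [fourierCoeff_eq_intervalIntegral _ _ (-π), ← cf_sp_neg]
    unfold cf
    rw [one_div, show -π + 2 * π = π by ring]
    congr 1
    refine intervalIntegral.integral_congr fun x _ => ?_
    rw [hfx, fourier_exp, smul_eq_mul, mul_comm]
  have hsum : Summable (fourierCoeff f) := by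
    have : (fourierCoeff f) = cf (sp (1 / 8)) := funext hco
    rw [this]
    exact K_summable.of_norm
  have h := (has_pointwise_sum_fourier_series_of_summable hsum ((-θ : ℝ) : AddCircle (2 * π))).tsum_eq
  rw [hfx] at h
  have e : sp (1 / 8) (-θ) = sp (1 / 8) θ := by simp [sp]
  rw [← e, ← h]
  unfold dtft
  refine tsum_congr fun n => ?_
  rw [hco, fourier_exp, smul_eq_mul]
  congr 2
  push_cast
  ring

lemma sin_ne_ae : ∀ᵐ θ : ℝ, Real.sin θ ≠ 0 := by
  have : {θ : ℝ | Real.sin θ = 0} = Set.range fun n : ℤ => (n : ℝ) * π := by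
    ext θ
    simp [Real.sin_eq_zero_iff]
  rw [ae_iff]
  simp only [not_not]
  rw [this]
  exact (Set.countable_range _).measure_zero _

lemma cf_congr {φ ψ : ℝ → ℂ} (h : ∀ᵐ θ : ℝ, φ θ = ψ θ) (n : ℤ) : cf φ n = cf ψ n := by
  unfold cf
  congr 1
  apply intervalIntegral.integral_congr_ae
  filter_upwards [h] with θ hθ _
  rw [hθ]

lemma sp_mul {θ : ℝ} (h : Real.sin θ ≠ 0) : sp (-(1 / 8)) θ * sp (1 / 8) θ = 1 := by
  unfold sp
  rw [← Complex.ofReal_mul, ← Real.rpow_add (abs_pos.2 h)]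
  norm_num

lemma cf_one (n : ℤ) : cf (fun _ => 1) n = if n = 0 then 1 else 0 := by
  have hp := Real.pi_pos
  have hpc : (π : ℂ) ≠ 0 := by exact_mod_cast hp.ne'
  unfold cf
  split_ifs with h
  · subst h
    simp
    field_simp
    ring
  · have hc : Complex.I * n ≠ 0 := mul_ne_zero Complex.I_ne_zero (by exact_mod_cast h)
    simp only [one_mul]
    rw [integral_exp_mul_complex hc, exp_pi]
    have : Complex.exp (Complex.I * n * ((-π : ℝ) : ℂ)) = (-1) ^ n := by
      have := exp_pi (-n)
      push_cast at this ⊢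
      rw [show Complex.I * n * -(π : ℂ) = Complex.I * -n * π by ring, this, zpow_neg, ← inv_zpow]
      norm_num
    rw [this]
    simp

lemma hinv (n j : ℤ) : ∑' m, cf (sp (-(1 / 8))) (n - m) * cf (sp (1 / 8)) (m - j) = if n = j then 1 else 0 := by
  have h := cf_conv (sp (-(1 / 8))) (sp_int _ (by norm_num) _ _) (cf (sp (1 / 8))) K_summable (n - j)
  rw [cf_congr (ψ := fun _ => 1), cf_one] at h
  · rw [← (Equiv.subRight j).tsum_eq] at h
    simp only [sub_eq_zero] at h
    rw [h]
    refine tsum_congr fun m => ?_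
    rw [Equiv.subRight_apply, sub_sub_sub_cancel_right, mul_comm]
  · filter_upwards [sin_ne_ae] with θ hθ
    rw [dtft_K, sp_mul hθ]

lemma f_rep (fh : ℝ → ℂ) (hu : IntervalIntegrable (fun θ => sp (-(1 / 8)) θ * fh θ) volume (-π) π) (m : ℤ) :
    cf fh m = ∑' j, cf (sp (1 / 8)) (m - j) * cf (fun θ => sp (-(1 / 8)) θ * fh θ) j := by
  have h := cf_conv _ hu (cf (sp (1 / 8))) K_summable m
  rw [cf_congr (ψ := fh)] at h
  · rw [h, ← (Equiv.subLeft m).tsum_eq]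
    refine tsum_congr fun j => ?_
    rw [Equiv.subLeft_apply, sub_sub_cancel]
  · filter_upwards [sin_ne_ae] with θ hθ
    rw [dtft_K]
    linear_combination fh θ * sp_mul hθ

lemma bessel (φ : ℝ → ℂ) (hm : AEStronglyMeasurable φ (volume.restrict (Set.Ioc (-π) π)))
    (hi : IntegrableOn (fun θ => ‖φ θ‖ ^ 2) (Set.Ioc (-π) π)) (F : Finset ℤ) :
    ∑ n ∈ F, ‖cf φ n‖ ^ 2 ≤ (2 * π)⁻¹ * ∫ θ in (-π)..π, ‖φ θ‖ ^ 2 := by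
  have hab : -π < π := by linarith [Real.pi_pos]
  have hL : MemLp φ 2 (volume.restrict (Set.Ioc (-π) π)) := (memLp_two_iff_integrable_sq_norm hm).2 hi
  have h := hasSum_sq_fourierCoeffOn hab hL
  have e : ∀ n, cf φ n = fourierCoeffOn hab φ (-n) := by
    intro n
    rw [fourierCoeffOn_eq_integral, neg_neg]
    unfold cf
    rw [one_div, show π - -π = 2 * π by ring]
    congr 1
    refine intervalIntegral.integral_congr fun x _ => ?_
    rw [fourier_exp, smul_eq_mul, mul_comm]
  rw [show π - -π = 2 * π by ring, smul_eq_mul] at h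
  have h2 := (Equiv.neg ℤ).hasSum_iff.2 h
  have h3 := sum_le_hasSum F (fun _ _ => sq_nonneg _) h2
  refine le_trans (le_of_eq ?_) h3
  refine Finset.sum_congr rfl fun n _ => ?_
  simp [e]

lemma abs_sin_mul (k : ℤ) (θ : ℝ) : |Real.sin (k * θ)| ≤ |(k : ℝ)| * |Real.sin θ| := by
  have hn : ∀ j : ℕ, |Real.sin (j * θ)| ≤ j * |Real.sin θ| := by
    intro j
    induction j with
    | zero => simp
    | succ j ih =>
      push_cast
      rw [add_mul, one_mul, Real.sin_add]
      calc _ ≤ |Real.sin (j * θ)| * |Real.cos θ| + |Real.cos (j * θ)| * |Real.sin θ| := by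
            rw [← abs_mul, ← abs_mul]; exact abs_add_le _ _
        _ ≤ |Real.sin (j * θ)| * 1 + 1 * |Real.sin θ| := by
            gcongr
            · exact Real.abs_cos_le_one _
            · exact Real.abs_cos_le_one _
        _ ≤ _ := by linarith
  rcases Int.natAbs_eq k with h | h
  · rw [h]; simpa using hn k.natAbs
  · rw [h]; simpa using hn k.natAbs

lemma sin_sum : ∃ C > 0, ∀ (F : Finset ℤ) (θ : ℝ),
    ∑ k ∈ F, br k ^ (-(7 / 4) : ℝ) * Real.sin (k * θ) ^ 2 ≤ C * |Real.sin θ| ^ (3 / 4 : ℝ) := by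
  obtain ⟨C0, hC0, H0⟩ := near_sum 0 (by norm_num) (by norm_num)
  obtain ⟨C1, hC1, H1⟩ := far_sum (7 / 4) (by norm_num)
  refine ⟨C0 + C1, by positivity, fun F θ => ?_⟩
  rcases (abs_nonneg (Real.sin θ)).eq_or_lt with h | h
  · rw [Finset.sum_eq_zero, ← h, Real.zero_rpow (by norm_num), mul_zero]
    intro k _
    have := abs_sin_mul k θ
    rw [← h, mul_zero] at this
    rw [abs_nonpos_iff.1 this]; simp
  set t := |Real.sin θ| with ht
  have hti : 0 < t⁻¹ := by positivity
  have hb := br_pos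
  rw [← Finset.sum_filter_add_sum_filter_not F (fun k => br k ≤ t⁻¹), add_mul]
  refine add_le_add ?_ ?_
  · calc _ ≤ ∑ k ∈ F with br k ≤ t⁻¹, (t⁻¹ ^ (1 / 4 : ℝ) * t ^ 2) * br k ^ (-0 : ℝ) := by
          apply Finset.sum_le_sum
          intro k hk
          have hk2 := (Finset.mem_filter.1 hk).2
          have h1 := abs_sin_mul k θ
          have h2 : Real.sin (k * θ) ^ 2 ≤ (br k) ^ 2 * t ^ 2 := by
            rw [← sq_abs, ← mul_pow]
            gcongr
            refine h1.trans ?_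
            gcongr
            unfold br; linarith
          have := hb k
          calc _ ≤ br k ^ (-(7 / 4) : ℝ) * ((br k) ^ 2 * t ^ 2) := by gcongr
            _ = br k ^ (1 / 4 : ℝ) * t ^ 2 := by
                rw [← mul_assoc, ← Real.rpow_natCast, ← Real.rpow_add this]; norm_num
            _ ≤ t⁻¹ ^ (1 / 4 : ℝ) * t ^ 2 := by gcongr
            _ = _ := by simp
      _ ≤ (t⁻¹ ^ (1 / 4 : ℝ) * t ^ 2) * (C0 * t⁻¹ ^ (1 - 0 : ℝ)) := by
          rw [← Finset.mul_sum]
          gcongr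
          exact H0 _ hti F
      _ = _ := by
          rw [Real.inv_rpow h.le, Real.inv_rpow h.le, ← Real.rpow_neg h.le, ← Real.rpow_neg h.le, ← Real.rpow_natCast]
          rw [show t ^ (-(1 / 4) : ℝ) * t ^ ((2 : ℕ) : ℝ) * (C0 * t ^ (-(1 - 0) : ℝ)) = C0 * (t ^ (-(1 / 4) : ℝ) * t ^ ((2 : ℕ) : ℝ) * (t ^ (-(1 - 0) : ℝ))) by ring,
            ← Real.rpow_add h, ← Real.rpow_add h]
          norm_num
  · calc _ ≤ ∑ k ∈ F with ¬ br k ≤ t⁻¹, br k ^ (-(7 / 4) : ℝ) := by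
          apply Finset.sum_le_sum
          intro k _
          have := hb k
          have h1 : Real.sin (k * θ) ^ 2 ≤ 1 := Real.sin_sq_le_one _
          calc _ ≤ br k ^ (-(7 / 4) : ℝ) * 1 := by gcongr
            _ = _ := mul_one _
      _ ≤ _ := H1 _ hti F
      _ = _ := by
          rw [Real.inv_rpow h.le, ← Real.rpow_neg h.le]; norm_num

lemma norm_exp_sub_one (k : ℤ) (θ : ℝ) :
    ‖Complex.exp (Complex.I * (2 * k : ℤ) * θ) - 1‖ ^ 2 = 4 * Real.sin (k * θ) ^ 2 := by
  have : Complex.exp (Complex.I * (2 * k : ℤ) * θ) - 1 =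
      Complex.exp (Complex.I * k * θ) * (2 * Complex.I * ((Real.sin (k * θ) : ℝ) : ℂ)) := by
    push_cast
    rw [Complex.sin]
    have e1 : Complex.exp (Complex.I * (2 * k) * θ) = Complex.exp (Complex.I * k * θ) * Complex.exp (Complex.I * k * θ) := by
      rw [← Complex.exp_add]; congr 1; ring
    have e2 : Complex.exp (Complex.I * k * θ) * Complex.exp (-(k * θ) * Complex.I) = 1 := by
      rw [← Complex.exp_add, show Complex.I * k * θ + -(k * θ) * Complex.I = 0 by ring, Complex.exp_zero]
    have e3 : Complex.exp (k * θ * Complex.I) = Complex.exp (Complex.I * k * θ) := by congr 1; ring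
    rw [e1, e3]
    linear_combination e2 - (Complex.exp (Complex.I * k * θ) * Complex.exp (-(k * θ) * Complex.I) - Complex.exp (Complex.I * k * θ) ^ 2) * Complex.I_sq
  rw [this, norm_mul, norm_exp_I, norm_mul, norm_mul, Complex.norm_I, Complex.norm_real, one_mul, mul_pow, Real.norm_eq_abs, sq_abs]
  norm_num

lemma seminorm_bd : ∃ C > 0, ∀ (gh : ℝ → ℂ), IntervalIntegrable gh volume (-π) π →
    IntegrableOn (fun θ => |Real.sin θ| ^ ((3 : ℝ) / 4) * ‖gh θ‖ ^ 2) (Set.Ioc (-π) π) → ∀ F1 F2 : Finset ℤ,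
    ∑ m ∈ F1, ∑ k ∈ F2, ‖cf gh (m + 2 * k) - cf gh m‖ ^ 2 * br k ^ (-(7 / 4) : ℝ) ≤
      C * ∫ θ in (-π)..π, |Real.sin θ| ^ ((3 : ℝ) / 4) * ‖gh θ‖ ^ 2 := by
  obtain ⟨C, hC, H⟩ := sin_sum
  refine ⟨(2 * π)⁻¹ * (4 * C), by positivity, ?_⟩
  intro gh hg hi F1 F2
  have hp : -π ≤ π := by linarith [Real.pi_pos]
  have hg' : IntegrableOn gh (Set.Ioc (-π) π) := (intervalIntegrable_iff_integrableOn_Ioc_of_le hp).1 hg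
  set ψ : ℤ → ℝ → ℂ := fun k θ => gh θ * (Complex.exp (Complex.I * (2 * k : ℤ) * θ) - 1) with hψ
  have hψn : ∀ k θ, ‖ψ k θ‖ ^ 2 = 4 * Real.sin (k * θ) ^ 2 * ‖gh θ‖ ^ 2 := by
    intro k θ
    simp only [hψ]
    rw [norm_mul, mul_pow, norm_exp_sub_one]; ring
  have hψm : ∀ k, AEStronglyMeasurable (ψ k) (volume.restrict (Set.Ioc (-π) π)) := fun k =>
    hg'.aestronglyMeasurable.mul (Continuous.aestronglyMeasurable (by fun_prop))
  have hψi : ∀ k, IntegrableOn (fun θ => ‖ψ k θ‖ ^ 2) (Set.Ioc (-π) π) := by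
    intro k
    refine Integrable.mono' (hi.const_mul (4 * (k : ℝ) ^ 2)) ((hψm k).norm.pow 2) ?_
    refine Filter.Eventually.of_forall fun θ => ?_
    rw [Real.norm_of_nonneg (by positivity), hψn]
    have h1 := abs_sin_mul k θ
    have h2 : Real.sin (k * θ) ^ 2 ≤ (k : ℝ) ^ 2 * |Real.sin θ| ^ (3 / 4 : ℝ) := by
      calc Real.sin (k * θ) ^ 2 = |Real.sin (k * θ)| ^ 2 := (sq_abs _).symm
        _ ≤ (|(k : ℝ)| * |Real.sin θ|) ^ 2 := by gcongr
        _ = (k : ℝ) ^ 2 * |Real.sin θ| ^ (2 : ℝ) := by rw [mul_pow, sq_abs, Real.rpow_two]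
        _ ≤ _ := by
          gcongr 1
          exact Real.rpow_le_rpow_of_exponent_ge' (abs_nonneg _) (Real.abs_sin_le_one _) (by norm_num) (by norm_num)
    calc _ ≤ 4 * ((k : ℝ) ^ 2 * |Real.sin θ| ^ (3 / 4 : ℝ)) * ‖gh θ‖ ^ 2 := by gcongr
      _ = _ := by ring
  have hcf : ∀ k m, cf gh (m + 2 * k) - cf gh m = cf (ψ k) m := by
    intro k m
    unfold cf
    rw [← smul_sub, ← intervalIntegral.integral_sub (exp_int _ _ _ hg _) (exp_int _ _ _ hg _)]
    congr 1
    refine intervalIntegral.integral_congr fun θ _ => ?_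
    simp only [hψ]
    rw [show Complex.I * (m + 2 * k : ℤ) * θ = Complex.I * (2 * k : ℤ) * θ + Complex.I * m * θ by push_cast; ring, Complex.exp_add]
    ring
  have hψi' : ∀ k, IntervalIntegrable (fun θ => ‖ψ k θ‖ ^ 2) volume (-π) π := fun k =>
    (intervalIntegrable_iff_integrableOn_Ioc_of_le hp).2 (hψi k)
  have hi' := (intervalIntegrable_iff_integrableOn_Ioc_of_le hp).2 hi
  calc _ = ∑ k ∈ F2, br k ^ (-(7 / 4) : ℝ) * ∑ m ∈ F1, ‖cf (ψ k) m‖ ^ 2 := by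
        rw [Finset.sum_comm]
        refine Finset.sum_congr rfl fun k _ => ?_
        rw [Finset.mul_sum]
        refine Finset.sum_congr rfl fun m _ => ?_
        rw [hcf, mul_comm]
    _ ≤ ∑ k ∈ F2, br k ^ (-(7 / 4) : ℝ) * ((2 * π)⁻¹ * ∫ θ in (-π)..π, ‖ψ k θ‖ ^ 2) := by
        refine Finset.sum_le_sum fun k _ => ?_
        have := br_pos k
        gcongr
        exact bessel _ (hψm k) (hψi k) F1
    _ = (2 * π)⁻¹ * ∫ θ in (-π)..π, ∑ k ∈ F2, br k ^ (-(7 / 4) : ℝ) * ‖ψ k θ‖ ^ 2 := by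
        rw [intervalIntegral.integral_finsetSum (fun k _ => (hψi' k).const_mul _), Finset.mul_sum]
        refine Finset.sum_congr rfl fun k _ => ?_
        rw [intervalIntegral.integral_const_mul]; ring
    _ ≤ (2 * π)⁻¹ * ∫ θ in (-π)..π, (4 * C) * (|Real.sin θ| ^ ((3 : ℝ) / 4) * ‖gh θ‖ ^ 2) := by
        gcongr
        apply intervalIntegral.integral_mono_on hp
        · have := IntervalIntegrable.sum F2 (f := fun k θ => br k ^ (-(7 / 4) : ℝ) * ‖ψ k θ‖ ^ 2) (μ := volume) (a := -π) (b := π)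
            (fun k _ => (hψi' k).const_mul _)
          have e : (fun θ => ∑ k ∈ F2, br k ^ (-(7 / 4) : ℝ) * ‖ψ k θ‖ ^ 2) =
              ∑ k ∈ F2, fun θ => br k ^ (-(7 / 4) : ℝ) * ‖ψ k θ‖ ^ 2 := by
            ext θ; simp
          rw [e]
          exact this
        · exact hi'.const_mul _
        · intro θ _
          have := H F2 θ
          calc _ = (∑ k ∈ F2, br k ^ (-(7 / 4) : ℝ) * Real.sin (k * θ) ^ 2) * (4 * ‖gh θ‖ ^ 2) := by
                rw [Finset.sum_mul]
                refine Finset.sum_congr rfl fun k _ => ?_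
                rw [hψn]; ring
            _ ≤ (C * |Real.sin θ| ^ (3 / 4 : ℝ)) * (4 * ‖gh θ‖ ^ 2) := by gcongr
            _ = _ := by ring
    _ = _ := by rw [intervalIntegral.integral_const_mul]; ring

lemma cf_undef (φ : ℝ → ℂ) (h : ¬ IntervalIntegrable φ volume (-π) π) (n : ℤ) : cf φ n = 0 := by
  unfold cf
  rw [intervalIntegral.integral_undef, smul_zero]
  intro hi
  apply h
  have := exp_int _ _ _ hi (-n)
  refine this.congr ?_
  intro θ _
  simp only
  rw [mul_assoc, ← Complex.exp_add, show Complex.I * n * θ + Complex.I * (-n : ℤ) * θ = 0 by push_cast; ring,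
    Complex.exp_zero, mul_one]

lemma lhs_zero (a : ℤ → ℂ) (ha : ∀ m, a m = 0) : 
    (∑' n : ℤ,
        ‖(2 * π)⁻¹ • ∫ θ in (-π)..π,
            (|Real.sin θ| ^ (-(1 : ℝ) / 8) : ℝ) •
              (dtft a θ * Complex.exp (Complex.I * n * θ))‖
          ^ ((4 : ℝ) / 3)) ^ ((3 : ℝ) / 4) = 0 := by
  have : ∀ θ, dtft a θ = 0 := fun θ => by simp [dtft, ha]
  simp only [this, zero_mul, smul_zero, intervalIntegral.integral_zero, norm_zero]
  rw [Real.zero_rpow (by norm_num), tsum_zero, Real.zero_rpow (by norm_num)]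

/-- Discrete paraproduct estimate
`‖|D_d|^{-1/8}(fgh)‖_{ℓ^{4/3}} ≲ ‖|D_d|^{-1/8}f‖_{ℓ²} ‖|D_d|^{3/8}g‖_{ℓ²} ‖|D_d|^{3/8}h‖_{ℓ²}`,
where `|D_d|^s` multiplies the DTFT by `|sin θ|^s`.  The sequences `f, g, h ∈ ℓ²` are
encoded via their DTFTs `fh, gh, hh`, and the right-hand `ℓ²` norms are expressed through
Plancherel as weighted `L²` norms of the DTFTs. -/
theorem stmt7 : ∃ C > 0, ∀ (f g h : ℤ → ℂ) (fh gh hh : ℝ → ℂ),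
    Summable (fun n : ℤ => ‖f n‖ ^ 2) → Summable (fun n : ℤ => ‖g n‖ ^ 2) →
    Summable (fun n : ℤ => ‖h n‖ ^ 2) →
    (∀ n : ℤ, f n = (2 * π)⁻¹ • ∫ θ in (-π)..π, fh θ * Complex.exp (Complex.I * n * θ)) →
    (∀ n : ℤ, g n = (2 * π)⁻¹ • ∫ θ in (-π)..π, gh θ * Complex.exp (Complex.I * n * θ)) →
    (∀ n : ℤ, h n = (2 * π)⁻¹ • ∫ θ in (-π)..π, hh θ * Complex.exp (Complex.I * n * θ)) →
    IntegrableOn (fun θ => |Real.sin θ| ^ (-(1 : ℝ) / 4) * ‖fh θ‖ ^ 2) (Set.Ioc (-π) π) →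
    IntegrableOn (fun θ => |Real.sin θ| ^ ((3 : ℝ) / 4) * ‖gh θ‖ ^ 2) (Set.Ioc (-π) π) →
    IntegrableOn (fun θ => |Real.sin θ| ^ ((3 : ℝ) / 4) * ‖hh θ‖ ^ 2) (Set.Ioc (-π) π) →
    (∑' n : ℤ,
        ‖(2 * π)⁻¹ • ∫ θ in (-π)..π,
            (|Real.sin θ| ^ (-(1 : ℝ) / 8) : ℝ) •
              (dtft (fun m => f m * g m * h m) θ * Complex.exp (Complex.I * n * θ))‖
          ^ ((4 : ℝ) / 3)) ^ ((3 : ℝ) / 4)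
      ≤ C * (∫ θ in (-π)..π, |Real.sin θ| ^ (-(1 : ℝ) / 4) * ‖fh θ‖ ^ 2) ^ ((1 : ℝ) / 2)
          * (∫ θ in (-π)..π, |Real.sin θ| ^ ((3 : ℝ) / 4) * ‖gh θ‖ ^ 2) ^ ((1 : ℝ) / 2)
          * (∫ θ in (-π)..π, |Real.sin θ| ^ ((3 : ℝ) / 4) * ‖hh θ‖ ^ 2) ^ ((1 : ℝ) / 2) := by
  obtain ⟨c1, hc1, hK⟩ := K_decay
  obtain ⟨c2, hc2, hkk⟩ := kk_decay
  obtain ⟨C1, hC1, H1⟩ := seminorm_bd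
  obtain ⟨C, hC, H⟩ := disc_full (c1 + c2) (by positivity)
  have hp : -π ≤ π := by linarith [Real.pi_pos]
  refine ⟨C * (2 * π)⁻¹ ^ ((1 : ℝ) / 2) * C1 ^ ((1 : ℝ) / 2) * C1 ^ ((1 : ℝ) / 2), by positivity, ?_⟩
  intro f g h fh gh hh hf hg hh2 hfe hge hhe hfi hgi hhi
  have hfe' : f = cf fh := funext hfe
  have hge' : g = cf gh := funext hge
  have hhe' : h = cf hh := funext hhe
  set If := ∫ θ in (-π)..π, |Real.sin θ| ^ (-(1 : ℝ) / 4) * ‖fh θ‖ ^ 2 with hIf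
  set Ig := ∫ θ in (-π)..π, |Real.sin θ| ^ ((3 : ℝ) / 4) * ‖gh θ‖ ^ 2 with hIg
  set Ih := ∫ θ in (-π)..π, |Real.sin θ| ^ ((3 : ℝ) / 4) * ‖hh θ‖ ^ 2 with hIh
  have hIf0 : 0 ≤ If := intervalIntegral.integral_nonneg hp fun θ _ => by positivity
  have hIg0 : 0 ≤ Ig := intervalIntegral.integral_nonneg hp fun θ _ => by positivity
  have hIh0 : 0 ≤ Ih := intervalIntegral.integral_nonneg hp fun θ _ => by positivity
  by_cases hF : IntervalIntegrable fh volume (-π) π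
  swap
  · rw [lhs_zero _ (fun m => by rw [hfe', cf_undef fh hF]; simp)]
    positivity
  by_cases hG : IntervalIntegrable gh volume (-π) π
  swap
  · rw [lhs_zero _ (fun m => by rw [hge', cf_undef gh hG]; simp)]
    positivity
  by_cases hH : IntervalIntegrable hh volume (-π) π
  swap
  · rw [lhs_zero _ (fun m => by rw [hhe', cf_undef hh hH]; simp)]
    positivity
  -- the auxiliary sequence u
  set uh : ℝ → ℂ := fun θ => sp (-(1 / 8)) θ * fh θ with huh
  have hF' : IntegrableOn fh (Set.Ioc (-π) π) := (intervalIntegrable_iff_integrableOn_Ioc_of_le hp).1 hF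
  have humeas : AEStronglyMeasurable uh (volume.restrict (Set.Ioc (-π) π)) :=
    (Complex.measurable_ofReal.comp (sin_rpow_meas _)).aestronglyMeasurable.mul hF'.aestronglyMeasurable
  have hunorm : ∀ θ, ‖uh θ‖ ^ 2 = |Real.sin θ| ^ (-(1 : ℝ) / 4) * ‖fh θ‖ ^ 2 := by
    intro θ
    simp only [huh, sp]
    rw [norm_mul, mul_pow, Complex.norm_real, Real.norm_of_nonneg (by positivity), ← Real.rpow_natCast,
      ← Real.rpow_mul (abs_nonneg _)]
    norm_num
  have hu2 : IntegrableOn (fun θ => ‖uh θ‖ ^ 2) (Set.Ioc (-π) π) := by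
    simp_rw [hunorm]; exact hfi
  have huint : IntervalIntegrable uh volume (-π) π := by
    rw [intervalIntegrable_iff_integrableOn_Ioc_of_le hp]
    exact ((memLp_two_iff_integrable_sq_norm humeas).2 hu2).integrable (by norm_num)
  have hubd : ∀ F : Finset ℤ, ∑ m ∈ F, ‖cf uh m‖ ^ 2 ≤ (((2 * π)⁻¹ * If) ^ ((1 : ℝ) / 2)) ^ 2 := by
    intro F
    have := bessel uh humeas hu2 F
    simp_rw [hunorm] at this
    rwa [← Real.rpow_natCast (((2 * π)⁻¹ * If) ^ ((1 : ℝ) / 2)), ← Real.rpow_mul (by positivity), 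
      show (1 : ℝ) / 2 * (2 : ℕ) = 1 by norm_num, Real.rpow_one]
  have hsq : ∀ t : ℝ, 0 ≤ t → (t ^ ((1 : ℝ) / 2)) ^ 2 = t := by
    intro t ht
    rw [← Real.rpow_natCast, ← Real.rpow_mul ht]; norm_num
  -- the output sequence
  have hprod : Summable fun m => ‖f m * g m * h m‖ := by
    have hfb : ∀ m, ‖f m‖ ≤ 1 + ∑' m, ‖f m‖ ^ 2 := fun m => by
      have := hf.le_tsum m (fun _ _ => by positivity)
      nlinarith [sq_nonneg (‖f m‖ - 1), norm_nonneg (f m)]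
    refine Summable.of_nonneg_of_le (fun _ => norm_nonneg _) (fun m => ?_)
      ((hg.add hh2).mul_left (1 + ∑' m, ‖f m‖ ^ 2))
    rw [mul_assoc, norm_mul, norm_mul]
    have h1 := hfb m
    have h2 : ‖g m‖ * ‖h m‖ ≤ ‖g m‖ ^ 2 + ‖h m‖ ^ 2 := by
      nlinarith [sq_nonneg (‖g m‖ - ‖h m‖), sq_nonneg (‖g m‖), sq_nonneg (‖h m‖)]
    gcongr
  have hLe : ∀ n : ℤ, (2 * π)⁻¹ • ∫ θ in (-π)..π,
            (|Real.sin θ| ^ (-(1 : ℝ) / 8) : ℝ) •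
              (dtft (fun m => f m * g m * h m) θ * Complex.exp (Complex.I * n * θ)) =
      ∑' m, cf (sp (-(1 / 8))) (n - m) * (f m * g m * h m) := by
    intro n
    have := cf_conv (sp (-(1 / 8))) (sp_int _ (by norm_num) _ _) (fun m => f m * g m * h m) hprod n
    rw [tsum_congr (fun m => mul_comm (cf (sp (-(1 / 8))) (n - m)) _), ← this]
    unfold cf
    congr 1
    refine intervalIntegral.integral_congr fun θ _ => ?_
    simp only [sp]
    rw [Complex.real_smul, ← mul_assoc, show (-(1:ℝ)/8) = -(1/8) by norm_num]
  have main := H (cf (sp (1 / 8))) (cf (sp (-(1 / 8)))) g h ((C1 * Ig) ^ ((1 : ℝ) / 2)) ((C1 * Ih) ^ ((1 : ℝ) / 2))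
    (((2 * π)⁻¹ * If) ^ ((1 : ℝ) / 2)) (cf uh) f
    (fun n => (2 * π)⁻¹ • ∫ θ in (-π)..π,
            (|Real.sin θ| ^ (-(1 : ℝ) / 8) : ℝ) •
              (dtft (fun m => f m * g m * h m) θ * Complex.exp (Complex.I * n * θ)))
    (fun k => (hK k).trans (by have := br_pos k; gcongr; linarith))
    (fun k => cf_sp_odd _ (by norm_num) k)
    (fun k => (hkk k).trans (by have := br_pos k; gcongr; linarith))
    K_summable hinv (by positivity) (by positivity) (by positivity) hubd hg hh2
    (by rw [hsq _ (by positivity), hge']; exact H1 gh hG hgi)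
    (by rw [hsq _ (by positivity), hhe']; exact H1 hh hH hhi)
    (by rw [hfe']; exact f_rep fh huint) hLe
  refine main.trans (le_of_eq ?_)
  rw [Real.mul_rpow (by positivity) hIf0, Real.mul_rpow (by positivity) hIg0, Real.mul_rpow (by positivity) hIh0]
  ring
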